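/- (Spectral restriction theorem for the Heisenberg nilmanifold, in explicit eigenfunction form.) For every ε > 0 there exists C_ε > 0 with the following property. Let μ > 0. Let (c_ω) be complex coefficients indexed by the (finite) set of ω ∈ ℤ² with 4π²(ω₁²+ω₂²) = μ², and let (γ_{λ,q,ℓ}) be complex coefficients indexed by the (finite) set of triples (λ,q,ℓ) with λ ∈ ℤ∖{0}, q ∈ ℤ/λℤ, ℓ ∈ ℕ and 2π|λ|(2ℓ+1) = μ². Then the function f(a,b,c) = ∑_ω c_ω e^{2πi(ω₁a+ω₂b)} + ∑_{(λ,q,ℓ)} γ_{λ,q,ℓ} h_{λ,q,ℓ}(a,b,c) satisfies (∫_{[0,1]³} |f|⁴)^{1/4} ≤ C_ε · μ^{1/2+ε} · (∑_ω |c_ω|² + ∑_{(λ,q,ℓ)} |γ_{λ,q,ℓ}|²)^{1/2}. -/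

import Mathlib

open MeasureTheory Real Complex
open scoped ComplexConjugate Classical

/-- Physicists' Hermite polynomial `H_ℓ(u) = (-1)^ℓ e^{u²} (d/du)^ℓ e^{-u²}`. -/
noncomputable def hermitePoly (ℓ : ℕ) (u : ℝ) : ℝ :=
  (-1 : ℝ) ^ ℓ * Real.exp (u ^ 2) * iteratedDeriv ℓ (fun t : ℝ => Real.exp (-t ^ 2)) u

/-- Normalised Hermite function `h_ℓ(u) = (√π 2^ℓ ℓ!)^{-1/2} H_ℓ(u) e^{-u²/2}`. -/
noncomputable def hermiteFun (ℓ : ℕ) (u : ℝ) : ℝ :=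
  (Real.sqrt π * 2 ^ ℓ * (ℓ.factorial : ℝ)) ^ (-(1 : ℝ) / 2) *
    hermitePoly ℓ u * Real.exp (-u ^ 2 / 2)

/-- Rescaled Hermite function `h_{ℓ,λ}(u) = (2π|λ|)^{1/4} h_ℓ(√(2π|λ|) u)`. -/
noncomputable def hermiteScaled (ℓ : ℕ) (lam : ℤ) (u : ℝ) : ℝ :=
  (2 * π * |(lam : ℝ)|) ^ ((1 : ℝ) / 4) * hermiteFun ℓ (Real.sqrt (2 * π * |(lam : ℝ)|) * u)

/-- The generalised Berezin–Weil–Zak transform. -/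
noncomputable def BWZ (lam q : ℤ) (h : ℝ → ℂ) (x : ℝ × ℝ × ℝ) : ℂ :=
  ((Real.sqrt |(lam : ℝ)| : ℝ) / (lam : ℝ) : ℝ) *
    ∑' k : ℤ, Complex.exp (-(2 * (π : ℂ) * Complex.I * (q : ℂ) * (k : ℂ)) / (lam : ℂ)) *
      Complex.exp (2 * (π : ℂ) * Complex.I * ((lam : ℂ) * (x.2.2 : ℂ) + (k : ℂ) * (x.2.1 : ℂ))) *
      h ((k : ℝ) / (lam : ℝ) + x.1)

/-- The eigenfunctions `h_{λ,q,ℓ} = BWZ_{λ,q}(h_{ℓ,λ})`. -/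
noncomputable def hBWZ (lam q : ℤ) (ℓ : ℕ) : ℝ × ℝ × ℝ → ℂ :=
  BWZ lam q (fun u => (hermiteScaled ℓ lam u : ℂ))

open Polynomial in
/-- The physicists' Hermite polynomials, as polynomials. -/
noncomputable def physHermite : ℕ → Polynomial ℝ
  | 0 => 1
  | n + 1 => 2 * X * physHermite n - derivative (physHermite n)

open Polynomial in
theorem derivative_physHermite_succ (n : ℕ) :
    derivative (physHermite (n + 1)) = 2 * ((n : ℝ[X]) + 1) * physHermite n := by
  induction n with
  | zero => simp [physHermite]
  | succ n ih =>
    rw [physHermite, derivative_sub, derivative_mul, ih]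
    simp only [derivative_mul, derivative_X, derivative_ofNat, derivative_add, derivative_natCast,
      derivative_one]
    have h : derivative (physHermite n) = 2 * X * physHermite n - physHermite (n + 1) := by
      rw [physHermite]; ring
    rw [h]
    push_cast
    ring

open Polynomial in
theorem physHermite_ode (n : ℕ) :
    derivative (derivative (physHermite n)) =
      2 * X * derivative (physHermite n) - 2 * (n : ℝ[X]) * physHermite n := by
  have h := derivative_physHermite_succ n
  rw [physHermite, derivative_sub, derivative_mul] at h
  simp only [derivative_mul, derivative_X, derivative_ofNat] at h
  linear_combination -h

theorem hasDerivAt_polynomial_mul_exp_neg_sq (p : Polynomial ℝ) (x : ℝ) :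
    HasDerivAt (fun t : ℝ => p.eval t * Real.exp (-t ^ 2))
      ((p.derivative - 2 * Polynomial.X * p).eval x * Real.exp (-x ^ 2)) x := by
  have h1 : HasDerivAt (fun t : ℝ => Real.exp (-t ^ 2)) (Real.exp (-x ^ 2) * (-(2 * x))) x := by
    simpa using ((hasDerivAt_pow 2 x).neg).exp
  refine ((p.hasDerivAt x).mul h1).congr_deriv ?_
  simp only [Polynomial.eval_sub, Polynomial.eval_mul, Polynomial.eval_X, Polynomial.eval_ofNat]
  ring

theorem iteratedDeriv_exp_neg_sq (n : ℕ) :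
    iteratedDeriv n (fun t : ℝ => Real.exp (-t ^ 2)) =
      fun t => ((-1) ^ n * physHermite n).eval t * Real.exp (-t ^ 2) := by
  induction n with
  | zero => simp [physHermite]
  | succ n ih =>
    rw [iteratedDeriv_succ, ih]
    funext x
    rw [(hasDerivAt_polynomial_mul_exp_neg_sq _ x).deriv]
    have hd : Polynomial.derivative ((-1 : Polynomial ℝ) ^ n) = 0 := by
      rcases neg_one_pow_eq_or (Polynomial ℝ) n with h | h <;> simp [h]
    rw [Polynomial.derivative_mul, hd, physHermite]
    congr 2
    ring

theorem hermitePoly_eq_eval (n : ℕ) (u : ℝ) : hermitePoly n u = (physHermite n).eval u := by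
  rw [hermitePoly, iteratedDeriv_exp_neg_sq]
  have h1 : Real.exp (u ^ 2) * Real.exp (-u ^ 2) = 1 := by rw [← Real.exp_add]; simp
  have h2 : ((-1 : ℝ) ^ n) * (-1) ^ n = 1 := by rw [← mul_pow]; simp
  simp only [Polynomial.eval_mul, Polynomial.eval_pow, Polynomial.eval_neg, Polynomial.eval_one]
  linear_combination (physHermite n).eval u * (Real.exp (u ^ 2) * Real.exp (-u ^ 2)) * h2 +
    (physHermite n).eval u * h1

theorem integrable_polynomial_mul_exp_neg_sq (p : Polynomial ℝ) :
    Integrable (fun t : ℝ => p.eval t * Real.exp (-t ^ 2)) := by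
  induction p using Polynomial.induction_on' with
  | add p q hp hq =>
    simp only [Polynomial.eval_add, add_mul]
    exact hp.add hq
  | monomial n a =>
    have h := (integrable_rpow_mul_exp_neg_mul_sq (b := 1) one_pos (s := (n : ℝ))
      (by have : (0 : ℝ) ≤ n := n.cast_nonneg
          linarith)).const_mul a
    refine h.congr (Filter.Eventually.of_forall fun x => ?_)
    simp [mul_assoc]

/-- The Gaussian moment functional `p ↦ ∫ p(t) e^{-t²} dt` on polynomials. -/
noncomputable def gaussMoment : Polynomial ℝ →ₗ[ℝ] ℝ where
  toFun p := ∫ t : ℝ, p.eval t * Real.exp (-t ^ 2)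
  map_add' p q := by
    simp only [Polynomial.eval_add, add_mul]
    exact integral_add (integrable_polynomial_mul_exp_neg_sq p)
      (integrable_polynomial_mul_exp_neg_sq q)
  map_smul' c p := by
    simp only [Polynomial.eval_smul, smul_eq_mul, mul_assoc, RingHom.id_apply]
    exact integral_const_mul _ _

theorem gaussMoment_apply (p : Polynomial ℝ) :
    gaussMoment p = ∫ t : ℝ, p.eval t * Real.exp (-t ^ 2) := rfl

/-- Integration by parts against the Gaussian weight. -/
theorem gaussMoment_derivative_sub (p : Polynomial ℝ) :
    gaussMoment (p.derivative - 2 * Polynomial.X * p) = 0 := by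
  rw [gaussMoment_apply]
  exact integral_eq_zero_of_hasDerivAt_of_integrable (hasDerivAt_polynomial_mul_exp_neg_sq p)
    (integrable_polynomial_mul_exp_neg_sq _) (integrable_polynomial_mul_exp_neg_sq p)

theorem gaussMoment_nonneg {p : Polynomial ℝ} (hp : ∀ t, 0 ≤ p.eval t) : 0 ≤ gaussMoment p :=
  integral_nonneg fun t => mul_nonneg (hp t) (Real.exp_pos _).le

theorem gaussMoment_physHermite_sq (n : ℕ) :
    gaussMoment (physHermite n ^ 2) = Real.sqrt π * 2 ^ n * (n.factorial : ℝ) := by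
  induction n with
  | zero =>
    have h := integral_gaussian 1
    simp only [neg_mul, one_mul, div_one] at h
    simp [gaussMoment_apply, physHermite, h]
  | succ n ih =>
    have h := gaussMoment_derivative_sub (physHermite (n + 1) * physHermite n)
    have e : physHermite (n + 1) ^ 2 = (2 * ((n : ℝ) + 1)) • physHermite n ^ 2 -
        (Polynomial.derivative (physHermite (n + 1) * physHermite n) -
          2 * Polynomial.X * (physHermite (n + 1) * physHermite n)) := by
      rw [Polynomial.derivative_mul, derivative_physHermite_succ, Polynomial.smul_eq_C_mul]
      simp only [physHermite, map_mul, map_add, map_natCast, map_one, map_ofNat]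
      ring
    rw [e, map_sub, h, map_smul, ih, Nat.factorial_succ]
    push_cast
    simp only [smul_eq_mul]
    ring

/-- The polynomial `q` for which `h_n' = q e^{-x²/2}` up to normalisation. -/
noncomputable def physHermiteAux (n : ℕ) : Polynomial ℝ :=
  Polynomial.derivative (physHermite n) - Polynomial.X * physHermite n

theorem gaussMoment_energy (n : ℕ) :
    gaussMoment (physHermiteAux n ^ 2) + gaussMoment ((Polynomial.X * physHermite n) ^ 2) =
      (2 * n + 1) * gaussMoment (physHermite n ^ 2) := by
  have h1 := gaussMoment_derivative_sub (physHermite n * physHermiteAux n)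
  have e : physHermiteAux n ^ 2 + (Polynomial.X * physHermite n) ^ 2 =
      (2 * (n : ℝ) + 1) • physHermite n ^ 2 +
        (Polynomial.derivative (physHermite n * physHermiteAux n) -
          2 * Polynomial.X * (physHermite n * physHermiteAux n)) := by
    rw [physHermiteAux, Polynomial.derivative_mul, Polynomial.derivative_sub,
      Polynomial.derivative_mul, physHermite_ode, Polynomial.smul_eq_C_mul]
    simp only [map_mul, map_add, map_natCast, map_one, map_ofNat, Polynomial.derivative_X]
    ring
  rw [← map_add, e, map_add, h1, map_smul]
  simp

theorem gaussMoment_weighted_energy_le (n : ℕ) :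
    gaussMoment ((Polynomial.X * physHermiteAux n) ^ 2) ≤
      (2 * n + 1) * gaussMoment ((Polynomial.X * physHermite n) ^ 2) +
        gaussMoment (physHermite n ^ 2) := by
  have h1 := gaussMoment_derivative_sub
    (Polynomial.X ^ 2 * (physHermite n * physHermiteAux n))
  have h2 := gaussMoment_derivative_sub (Polynomial.X * physHermite n ^ 2)
  have h3 : 0 ≤ gaussMoment ((Polynomial.X ^ 2 * physHermite n) ^ 2) :=
    gaussMoment_nonneg fun t => by simp only [Polynomial.eval_pow]; positivity
  have e : (Polynomial.X * physHermiteAux n) ^ 2 =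
      (2 * (n : ℝ) + 1) • (Polynomial.X * physHermite n) ^ 2 + physHermite n ^ 2
        - (Polynomial.X ^ 2 * physHermite n) ^ 2 +
        (Polynomial.derivative (Polynomial.X ^ 2 * (physHermite n * physHermiteAux n)) -
          2 * Polynomial.X * (Polynomial.X ^ 2 * (physHermite n * physHermiteAux n))) -
        (Polynomial.derivative (Polynomial.X * physHermite n ^ 2) -
          2 * Polynomial.X * (Polynomial.X * physHermite n ^ 2)) := by
    rw [physHermiteAux]
    simp only [Polynomial.derivative_mul, Polynomial.derivative_sub,
      Polynomial.derivative_pow, physHermite_ode, Polynomial.smul_eq_C_mul]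
    simp only [map_mul, map_add, map_natCast, map_one, map_ofNat, Polynomial.derivative_X]
    push_cast
    ring
  rw [e, map_sub, map_add, h1, h2, map_sub, map_add, map_smul, smul_eq_mul]
  linarith
theorem le_integral_add_integral_of_abs_deriv_le {f f' g : ℝ → ℝ}
    (hf : ∀ x, HasDerivAt f (f' x) x) (hf' : Continuous f') (hg : ∀ x, |f' x| ≤ g x)
    (hgi : Integrable g) {δ : ℝ} (hδ : 0 < δ) (x : ℝ) :
    f x ≤ ∫ y in Set.Ioc x (x + δ), (δ⁻¹ * f y + g y) := by
  have hfc : Continuous f := continuous_iff_continuousAt.2 fun x => (hf x).continuousAt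
  have hle : x ≤ x + δ := by linarith
  have hgl : IntervalIntegrable g volume x (x + δ) := hgi.intervalIntegrable
  have key : ∀ y ∈ Set.Icc x (x + δ), f x ≤ f y + ∫ t in x..(x + δ), g t := by
    intro y hy
    have h1 : ∫ t in x..y, f' t = f y - f x :=
      intervalIntegral.integral_eq_sub_of_hasDerivAt (fun t _ => hf t)
        (hf'.intervalIntegrable _ _)
    have h2 : -∫ t in x..y, f' t ≤ ∫ t in x..y, g t := by
      rw [← intervalIntegral.integral_neg]
      exact intervalIntegral.integral_mono_on hy.1 (hf'.neg.intervalIntegrable _ _)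
        hgi.intervalIntegrable fun t _ => (neg_le_abs _).trans (hg t)
    have h3 : ∫ t in x..y, g t ≤ ∫ t in x..(x + δ), g t :=
      intervalIntegral.integral_mono_interval le_rfl hy.1 hy.2
        (Filter.Eventually.of_forall fun t => (abs_nonneg _).trans (hg t)) hgl
    linarith
  have h4 : ∫ _ in x..(x + δ), f x ≤ ∫ y in x..(x + δ), (f y + ∫ t in x..(x + δ), g t) :=
    intervalIntegral.integral_mono_on hle intervalIntegrable_const
      ((hfc.add continuous_const).intervalIntegrable _ _) key
  rw [intervalIntegral.integral_add (hfc.intervalIntegrable _ _) intervalIntegrable_const,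
    intervalIntegral.integral_const, intervalIntegral.integral_const] at h4
  rw [← intervalIntegral.integral_of_le hle,
    intervalIntegral.integral_add ((hfc.intervalIntegrable _ _).const_mul _) hgl,
    intervalIntegral.integral_const_mul]
  simp only [add_sub_cancel_left, smul_eq_mul] at h4
  have h5 := mul_le_mul_of_nonneg_left h4 (inv_pos.2 hδ).le
  rw [mul_add, inv_mul_cancel_left₀ hδ.ne', inv_mul_cancel_left₀ hδ.ne'] at h5
  exact h5

/-- Sampling inequality: a sum over an arithmetic progression is controlled by integrals of the
function and of its derivative. -/
theorem tsum_sample_le {f f' g : ℝ → ℝ} (hf0 : ∀ x, 0 ≤ f x)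
    (hf : ∀ x, HasDerivAt f (f' x) x) (hf' : Continuous f') (hg : ∀ x, |f' x| ≤ g x)
    (hfi : Integrable f) (hgi : Integrable g) {δ : ℝ} (hδ : 0 < δ) (x : ℝ) :
    ∑' k : ℤ, ENNReal.ofReal (f (x + k * δ)) ≤
      ENNReal.ofReal (δ⁻¹ * (∫ y, f y) + ∫ y, g y) := by
  have hGi : Integrable fun y => δ⁻¹ * f y + g y := (hfi.const_mul _).add hgi
  have hG0 : ∀ y, 0 ≤ δ⁻¹ * f y + g y := fun y =>
    add_nonneg (mul_nonneg (inv_pos.2 hδ).le (hf0 y)) ((abs_nonneg _).trans (hg y))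
  have hsum := hasSum_integral_iUnion (f := fun y => δ⁻¹ * f y + g y) (μ := volume)
    (s := fun n : ℤ => Set.Ioc (x + n • δ) (x + (n + 1) • δ))
    (fun _ => measurableSet_Ioc) (Set.pairwise_disjoint_Ioc_add_zsmul x δ) hGi.integrableOn
  rw [iUnion_Ioc_add_zsmul hδ, setIntegral_univ, integral_add (hfi.const_mul _) hgi,
    integral_const_mul] at hsum
  rw [← hsum.tsum_eq, ENNReal.ofReal_tsum_of_nonneg
    (fun n => setIntegral_nonneg measurableSet_Ioc fun y _ => hG0 y) hsum.summable]
  refine ENNReal.tsum_le_tsum fun k => ENNReal.ofReal_le_ofReal ?_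
  have h := le_integral_add_integral_of_abs_deriv_le hf hf' hg hgi hδ (x + k * δ)
  have e1 : x + k * δ = x + k • δ := by simp
  have e2 : x + k * δ + δ = x + (k + 1) • δ := by simp; ring
  rw [e2, e1] at h
  rwa [e1]

theorem hermiteFun_sq (n : ℕ) (u : ℝ) :
    hermiteFun n u ^ 2 =
      (gaussMoment (physHermite n ^ 2))⁻¹ * ((physHermite n ^ 2).eval u * Real.exp (-u ^ 2)) := by
  have hpos : 0 < Real.sqrt π * 2 ^ n * (n.factorial : ℝ) := by positivity
  have h1 : ((Real.sqrt π * 2 ^ n * (n.factorial : ℝ)) ^ (-(1 : ℝ) / 2)) ^ 2 =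
      (Real.sqrt π * 2 ^ n * (n.factorial : ℝ))⁻¹ := by
    rw [← Real.rpow_natCast, ← Real.rpow_mul hpos.le, ← Real.rpow_neg_one]
    norm_num
  have h2 : Real.exp (-u ^ 2 / 2) ^ 2 = Real.exp (-u ^ 2) := by
    rw [← Real.exp_nat_mul]; congr 1; push_cast; ring
  rw [hermiteFun, mul_pow, mul_pow, h1, h2, hermitePoly_eq_eval, gaussMoment_physHermite_sq,
    Polynomial.eval_pow, mul_assoc]

theorem gaussMoment_physHermite_sq_pos (n : ℕ) : 0 < gaussMoment (physHermite n ^ 2) := by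
  rw [gaussMoment_physHermite_sq]; positivity

theorem integrable_hermiteFun_sq (n : ℕ) : Integrable fun u => hermiteFun n u ^ 2 := by
  simp only [hermiteFun_sq]
  exact (integrable_polynomial_mul_exp_neg_sq _).const_mul _

theorem integral_hermiteFun_sq (n : ℕ) : ∫ u, hermiteFun n u ^ 2 = 1 := by
  simp only [hermiteFun_sq]
  rw [integral_const_mul, ← gaussMoment_apply,
    inv_mul_cancel₀ (gaussMoment_physHermite_sq_pos n).ne']

theorem continuous_hermiteFun (n : ℕ) : Continuous (hermiteFun n) := by
  have : hermiteFun n = fun u => (Real.sqrt π * 2 ^ n * (n.factorial : ℝ)) ^ (-(1 : ℝ) / 2) *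
      (physHermite n).eval u * Real.exp (-u ^ 2 / 2) := by
    funext u; rw [hermiteFun, hermitePoly_eq_eval]
  rw [this]
  fun_prop

theorem tsum_weighted_hermiteFun_le (n : ℕ) {δ : ℝ} (hδ : 0 < δ) (x : ℝ) :
    ∑' k : ℤ, ENNReal.ofReal
        ((1 + (x + k * δ) ^ 2 / (2 * n + 1)) * hermiteFun n (x + k * δ) ^ 2) ≤
      ENNReal.ofReal (2 * δ⁻¹ + 8 * Real.sqrt (2 * n + 1)) := by
  set N : ℝ := 2 * n + 1 with hN
  have hN1 : 1 ≤ N := by rw [hN]; linarith [(n.cast_nonneg : (0 : ℝ) ≤ n)]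
  have hN0 : 0 < N := by linarith
  set r : ℝ := Real.sqrt N with hr
  have hr1 : 1 ≤ r := Real.one_le_sqrt.2 hN1
  have hr0 : 0 < r := by linarith
  have hrN : r ^ 2 = N := Real.sq_sqrt hN0.le
  set M := gaussMoment (physHermite n ^ 2) with hM
  have hM0 : 0 < M := gaussMoment_physHermite_sq_pos n
  set A := gaussMoment ((Polynomial.X * physHermite n) ^ 2) with hA
  set B := gaussMoment (physHermiteAux n ^ 2) with hB
  set D := gaussMoment ((Polynomial.X * physHermiteAux n) ^ 2) with hD
  have hA0 : 0 ≤ A := gaussMoment_nonneg fun t => by rw [Polynomial.eval_pow]; positivity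
  have hB0 : 0 ≤ B := gaussMoment_nonneg fun t => by rw [Polynomial.eval_pow]; positivity
  have hAB : B + A = N * M := gaussMoment_energy n
  have hDle : D ≤ N * A + M := gaussMoment_weighted_energy_le n
  set p : Polynomial ℝ := M⁻¹ • (physHermite n ^ 2 + N⁻¹ • (Polynomial.X * physHermite n) ^ 2)
    with hp
  set q : Polynomial ℝ := M⁻¹ • ((r + N⁻¹) • physHermite n ^ 2 + r⁻¹ • physHermiteAux n ^ 2 +
    (N⁻¹ * r + N⁻¹) • (Polynomial.X * physHermite n) ^ 2 +
    (N⁻¹ * r⁻¹) • (Polynomial.X * physHermiteAux n) ^ 2) with hq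
  have hpe : ∀ u, (1 + u ^ 2 / N) * hermiteFun n u ^ 2 = p.eval u * Real.exp (-u ^ 2) := by
    intro u
    rw [hermiteFun_sq]
    simp only [hp, Polynomial.eval_smul, Polynomial.eval_add, Polynomial.eval_pow,
      Polynomial.eval_mul, Polynomial.eval_X, smul_eq_mul]
    ring
  have hip : gaussMoment p ≤ 2 := by
    simp only [hp, map_smul, map_add, smul_eq_mul, ← hM, ← hA]
    rw [inv_mul_le_iff₀ hM0]
    have : N⁻¹ * A ≤ M := by rw [inv_mul_le_iff₀ hN0]; linarith
    linarith
  have hiq : gaussMoment q ≤ 8 * r := by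
    simp only [hq, map_smul, map_add, smul_eq_mul, ← hM, ← hA, ← hB, ← hD]
    rw [inv_mul_le_iff₀ hM0]
    have hNinv : N⁻¹ ≤ 1 := inv_le_one_of_one_le₀ hN1
    have hA' : N⁻¹ * A ≤ M := by rw [inv_mul_le_iff₀ hN0]; linarith
    have hB' : r⁻¹ * B ≤ r * M := by
      rw [inv_mul_le_iff₀ hr0]; nlinarith
    have hD' : N⁻¹ * r⁻¹ * D ≤ 2 * (r * M) := by
      rw [← mul_inv, inv_mul_le_iff₀ (by positivity)]
      have : N * r * (2 * (r * M)) = 2 * N ^ 2 * M := by rw [← hrN]; ring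
      rw [this]
      nlinarith [mul_nonneg hM0.le (sub_nonneg.2 hN1), mul_nonneg hN0.le hB0]
    have hMr : M ≤ r * M := by nlinarith
    have h6 : N⁻¹ * M ≤ M := by nlinarith
    have h7 : N⁻¹ * r * A ≤ r * M := by nlinarith
    nlinarith
  have hder : ∀ u, |(p.derivative - 2 * Polynomial.X * p).eval u * Real.exp (-u ^ 2)| ≤
      q.eval u * Real.exp (-u ^ 2) := by
    intro u
    rw [abs_mul, abs_of_pos (Real.exp_pos _)]
    refine mul_le_mul_of_nonneg_right ?_ (Real.exp_pos _).le
    have e1 : p.derivative - 2 * Polynomial.X * p =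
        M⁻¹ • (2 * physHermite n * physHermiteAux n +
          N⁻¹ • (2 * Polynomial.X ^ 2 * physHermite n * physHermiteAux n +
            2 * Polynomial.X * physHermite n ^ 2)) := by
      simp only [hp, physHermiteAux, Polynomial.derivative_add, Polynomial.derivative_C,
        Polynomial.derivative_pow, Polynomial.derivative_mul, Polynomial.smul_eq_C_mul,
        Polynomial.derivative_X, Nat.cast_ofNat, map_ofNat]
      ring
    rw [e1]
    simp only [hq, Polynomial.eval_smul, Polynomial.eval_add, Polynomial.eval_pow,
      Polynomial.eval_mul, Polynomial.eval_X, Polynomial.eval_ofNat, smul_eq_mul]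
    rw [abs_mul, abs_of_pos (inv_pos.2 hM0)]
    refine mul_le_mul_of_nonneg_left ?_ (inv_pos.2 hM0).le
    generalize (physHermite n).eval u = P
    generalize (physHermiteAux n).eval u = Q
    have hri : r * r⁻¹ = 1 := mul_inv_cancel₀ hr0.ne'
    have hri0 : 0 < r⁻¹ := inv_pos.2 hr0
    have hNi0 : 0 < N⁻¹ := inv_pos.2 hN0
    have h1 : ∀ P Q : ℝ, |2 * P * Q| ≤ r * P ^ 2 + r⁻¹ * Q ^ 2 := by
      intro P Q
      have e : r * P ^ 2 = r⁻¹ * (r * P) ^ 2 := by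
        linear_combination (-(r * P ^ 2)) * hri
      have e' : 2 * P * Q = r⁻¹ * (2 * (r * P) * Q) := by
        linear_combination (-(2 * P * Q)) * hri
      rw [e, e', ← mul_add, abs_mul, abs_of_pos hri0]
      refine mul_le_mul_of_nonneg_left (abs_le.2 ⟨?_, ?_⟩) hri0.le
      · nlinarith [sq_nonneg (r * P + Q)]
      · nlinarith [sq_nonneg (r * P - Q)]
    have h2 : |2 * u * P ^ 2| ≤ P ^ 2 + (u * P) ^ 2 := by
      rw [abs_le]
      constructor <;> nlinarith [sq_nonneg (P + u * P), sq_nonneg (P - u * P)]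
    have h3 := h1 (u * P) (u * Q)
    calc |2 * P * Q + N⁻¹ * (2 * u ^ 2 * P * Q + 2 * u * P ^ 2)|
        ≤ |2 * P * Q| + N⁻¹ * (|2 * (u * P) * (u * Q)| + |2 * u * P ^ 2|) := by
          refine (abs_add_le _ _).trans (add_le_add_right ?_ _)
          rw [abs_mul, abs_of_pos hNi0]
          refine mul_le_mul_of_nonneg_left ?_ hNi0.le
          refine (abs_add_le _ _).trans (le_of_eq ?_)
          congr 2; ring
      _ ≤ (r * P ^ 2 + r⁻¹ * Q ^ 2) + N⁻¹ * ((r * (u * P) ^ 2 + r⁻¹ * (u * Q) ^ 2) +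
            (P ^ 2 + (u * P) ^ 2)) := by
          gcongr
          exact h1 P Q
      _ = _ := by ring
  simp only [hpe]
  refine (tsum_sample_le (fun u => ?_) (hasDerivAt_polynomial_mul_exp_neg_sq p) (by fun_prop)
    hder (integrable_polynomial_mul_exp_neg_sq p) (integrable_polynomial_mul_exp_neg_sq q)
    hδ x).trans (ENNReal.ofReal_le_ofReal ?_)
  · rw [← hpe]; positivity
  · rw [← gaussMoment_apply, ← gaussMoment_apply]
    have := mul_le_mul_of_nonneg_left hip (inv_pos.2 hδ).le
    linarith

theorem tsum_inv_one_add_sq_le {δ : ℝ} (hδ : 0 < δ) (x : ℝ) :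
    ∑' k : ℤ, ENNReal.ofReal ((1 + (x + k * δ) ^ 2)⁻¹) ≤
      ENNReal.ofReal (π * (δ⁻¹ + 1)) := by
  have hpos : ∀ y : ℝ, 0 < 1 + y ^ 2 := fun y => by positivity
  refine (tsum_sample_le (f := fun y => (1 + y ^ 2)⁻¹)
    (f' := fun y => -(2 * y) / (1 + y ^ 2) ^ 2) (g := fun y => (1 + y ^ 2)⁻¹)
    (fun y => (inv_pos.2 (hpos y)).le) (fun y => ?_) ?_ (fun y => ?_) integrable_inv_one_add_sq
    integrable_inv_one_add_sq hδ x).trans (ENNReal.ofReal_le_ofReal (le_of_eq ?_))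
  · have := ((hasDerivAt_pow 2 y).const_add 1).inv (hpos y).ne'
    refine this.congr_deriv ?_
    norm_num
  · exact Continuous.div (by fun_prop) (by fun_prop) fun y => (pow_pos (hpos y) 2).ne'
  · rw [abs_div, abs_of_pos (pow_pos (hpos y) 2), div_le_iff₀ (pow_pos (hpos y) 2),
      pow_two (1 + y ^ 2),
      inv_mul_cancel_left₀ (hpos y).ne', abs_le]
    constructor <;> nlinarith [sq_nonneg (y - 1), sq_nonneg (y + 1)]
  · rw [integral_univ_inv_one_add_sq]; ring
theorem ENNReal.tsum_mul_sq_le {ι : Type*} (f g : ι → ENNReal) :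
    (∑' i, f i * g i) ^ 2 ≤ (∑' i, f i ^ 2) * ∑' i, g i ^ 2 := by
  let _ : MeasurableSpace ι := ⊤
  have h := ENNReal.lintegral_mul_le_Lp_mul_Lq Measure.count Real.HolderConjugate.two_two
    (f := f) (g := g) measurable_from_top.aemeasurable measurable_from_top.aemeasurable
  simp only [lintegral_count, Pi.mul_apply, ENNReal.rpow_ofNat] at h
  calc (∑' i, f i * g i) ^ 2
      ≤ ((∑' i, f i ^ 2) ^ (1 / 2 : ℝ) * (∑' i, g i ^ 2) ^ (1 / 2 : ℝ)) ^ 2 := by gcongr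
    _ = _ := by
      rw [mul_pow, ← ENNReal.rpow_natCast, ← ENNReal.rpow_natCast, ← ENNReal.rpow_mul,
        ← ENNReal.rpow_mul]
      norm_num

theorem tsum_int_div_eq_tsum_int_div_natAbs (lam : ℤ) (g : ℝ → ENNReal) :
    ∑' k : ℤ, g (k / (lam : ℝ)) = ∑' k : ℤ, g (k / (lam.natAbs : ℝ)) := by
  rcases Int.natAbs_eq lam with h | h
  · have : (lam : ℝ) = (lam.natAbs : ℝ) := by
      conv_lhs => rw [h]
      simp
    rw [this]
  · have : (lam : ℝ) = -(lam.natAbs : ℝ) := by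
      conv_lhs => rw [h]
      simp
    rw [this, ← (Equiv.neg ℤ).tsum_eq]
    refine tsum_congr fun k => ?_
    simp [neg_div_neg_eq]

theorem tsum_int_eq_sum_tsum (d : ℕ) [NeZero d] (g : ℤ → ENNReal) :
    ∑' k : ℤ, g k = ∑ r : Fin d, ∑' m : ℤ, g (m * d + (r : ℕ)) := by
  rw [← (Int.divModEquiv d).symm.tsum_eq, ENNReal.tsum_prod', ENNReal.tsum_comm, tsum_fintype]
  simp [Int.divModEquiv]

theorem two_pi_abs_pos {lam : ℤ} (hl : lam ≠ 0) : 0 < 2 * π * |(lam : ℝ)| := by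
  have : 0 < |(lam : ℝ)| := abs_pos.2 (Int.cast_ne_zero.2 hl)
  positivity

theorem hermiteScaled_sq (n : ℕ) {lam : ℤ} (hl : lam ≠ 0) (u : ℝ) :
    hermiteScaled n lam u ^ 2 = Real.sqrt (2 * π * |(lam : ℝ)|) *
      hermiteFun n (Real.sqrt (2 * π * |(lam : ℝ)|) * u) ^ 2 := by
  rw [hermiteScaled, mul_pow, ← Real.rpow_natCast, ← Real.rpow_mul (two_pi_abs_pos hl).le,
    Real.sqrt_eq_rpow]
  norm_num

/-- The weight balancing the Hermite function of degree `n` at frequency `lam`. -/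
noncomputable def hermiteWeight (n : ℕ) (lam : ℤ) (u : ℝ) : ℝ :=
  1 + (Real.sqrt (2 * π * |(lam : ℝ)|) * u) ^ 2 / (2 * n + 1)

theorem hermiteWeight_pos (n : ℕ) (lam : ℤ) (u : ℝ) : 0 < hermiteWeight n lam u := by
  rw [hermiteWeight]; positivity

theorem tsum_weighted_hermiteScaled_le (n : ℕ) {lam : ℤ} (hl : lam ≠ 0) (a : ℝ) :
    ∑' k : ℤ, ENNReal.ofReal (hermiteWeight n lam (k / (lam : ℝ) + a) *
        hermiteScaled n lam (k / (lam : ℝ) + a) ^ 2) ≤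
      ENNReal.ofReal (2 * |(lam : ℝ)| +
        8 * (Real.sqrt (2 * π * |(lam : ℝ)|) * Real.sqrt (2 * n + 1))) := by
  rw [tsum_int_div_eq_tsum_int_div_natAbs lam fun u => ENNReal.ofReal
    (hermiteWeight n lam (u + a) * hermiteScaled n lam (u + a) ^ 2)]
  have hd : (lam.natAbs : ℝ) = |(lam : ℝ)| := by simp
  have hl0 : 0 < |(lam : ℝ)| := abs_pos.2 (Int.cast_ne_zero.2 hl)
  simp only [hermiteScaled_sq n hl, hermiteWeight, hd]
  have hs0 : 0 < Real.sqrt (2 * π * |(lam : ℝ)|) := Real.sqrt_pos.2 (two_pi_abs_pos hl)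
  generalize Real.sqrt (2 * π * |(lam : ℝ)|) = s at *
  have h := tsum_weighted_hermiteFun_le n (div_pos hs0 hl0) (s * a)
  have e : ∀ k : ℤ, s * a + k * (s / |(lam : ℝ)|) = s * (k / |(lam : ℝ)| + a) := fun k => by ring
  simp only [e] at h
  calc _ = ENNReal.ofReal s * ∑' k : ℤ, ENNReal.ofReal
        ((1 + (s * (k / |(lam : ℝ)| + a)) ^ 2 / (2 * n + 1)) *
          hermiteFun n (s * (k / |(lam : ℝ)| + a)) ^ 2) := by
        rw [← ENNReal.tsum_mul_left]
        refine tsum_congr fun k => ?_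
        rw [← ENNReal.ofReal_mul hs0.le]
        congr 1; ring
    _ ≤ ENNReal.ofReal s * ENNReal.ofReal _ := by gcongr
    _ = _ := by
        rw [← ENNReal.ofReal_mul hs0.le]
        congr 1
        field_simp

theorem tsum_inv_hermiteWeight_le (n : ℕ) {lam : ℤ} (hl : lam ≠ 0) (r : ℤ) (a : ℝ) :
    ∑' m : ℤ, ENNReal.ofReal
        ((hermiteWeight n lam (((m * lam.natAbs + r : ℤ) : ℝ) / (lam : ℝ) + a))⁻¹) ≤
      ENNReal.ofReal (π * (Real.sqrt (2 * n + 1) / Real.sqrt (2 * π * |(lam : ℝ)|) + 1)) := by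
  have hl0 : (lam : ℝ) ≠ 0 := Int.cast_ne_zero.2 hl
  have hs0 : 0 < Real.sqrt (2 * π * |(lam : ℝ)|) := Real.sqrt_pos.2 (two_pi_abs_pos hl)
  simp only [hermiteWeight]
  generalize Real.sqrt (2 * π * |(lam : ℝ)|) = s at *
  have hN0 : (0 : ℝ) < 2 * n + 1 := by positivity
  have hr0 : 0 < Real.sqrt (2 * n + 1) := Real.sqrt_pos.2 hN0
  have hrN : Real.sqrt (2 * n + 1) ^ 2 = 2 * n + 1 := Real.sq_sqrt hN0.le
  generalize Real.sqrt (2 * n + 1) = t at *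
  have h := tsum_inv_one_add_sq_le (div_pos hs0 hr0) (s / t * (r / lam + a))
  rw [inv_div] at h
  refine le_trans (le_of_eq ?_) h
  have e : ∀ u : ℝ, (s * u) ^ 2 / (2 * n + 1) = (s / t * u) ^ 2 := fun u => by
    rw [← hrN]; ring
  simp only [e]
  rcases Int.natAbs_eq lam with hh | hh
  · refine tsum_congr fun m => ?_
    have h1 : ((lam.natAbs : ℤ) : ℝ) = lam := by rw [← hh]
    congr 4
    push_cast at h1 ⊢
    rw [h1]
    field_simp
    ring
  · rw [← (Equiv.neg ℤ).tsum_eq]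
    refine tsum_congr fun m => ?_
    have h1 : ((lam.natAbs : ℤ) : ℝ) = -lam := by conv_rhs => rw [hh]
                                                  simp
    congr 4
    push_cast at h1 ⊢
    simp only [Equiv.neg_apply, Int.cast_neg, h1]
    field_simp
    ring

/-- Pointwise bound for lattice sums of Hermite functions with periodic coefficients. -/
theorem tsum_periodic_mul_hermiteScaled_sq_le (n : ℕ) {lam : ℤ} (hl : lam ≠ 0) {F : ℤ → ENNReal}
    (hF : ∀ m r : ℤ, F (m * lam.natAbs + r) = F r) (a : ℝ) :
    (∑' k : ℤ, F k * ENNReal.ofReal |hermiteScaled n lam (k / (lam : ℝ) + a)|) ^ 2 ≤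
      ENNReal.ofReal (152 * (|(lam : ℝ)| + (2 * n + 1))) *
        ∑ r : Fin lam.natAbs, F (r : ℕ) ^ 2 := by
  have : NeZero lam.natAbs := ⟨Int.natAbs_ne_zero.2 hl⟩
  set w : ℤ → ℝ := fun k => hermiteWeight n lam (k / (lam : ℝ) + a) with hw
  have hw0 : ∀ k, 0 < w k := fun k => hermiteWeight_pos _ _ _
  have hsplit : ∀ k : ℤ, F k * ENNReal.ofReal |hermiteScaled n lam (k / (lam : ℝ) + a)| =
      (F k * ENNReal.ofReal (Real.sqrt (w k)⁻¹)) *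
        ENNReal.ofReal (Real.sqrt (w k) * |hermiteScaled n lam (k / (lam : ℝ) + a)|) := by
    intro k
    rw [mul_assoc, ← ENNReal.ofReal_mul (Real.sqrt_nonneg _), ← mul_assoc, ← Real.sqrt_mul
      (inv_pos.2 (hw0 k)).le, inv_mul_cancel₀ (hw0 k).ne', Real.sqrt_one, one_mul]
  simp only [hsplit]
  refine (ENNReal.tsum_mul_sq_le _ _).trans ?_
  have h1 : ∑' k : ℤ, (F k * ENNReal.ofReal (Real.sqrt (w k)⁻¹)) ^ 2 ≤
      (∑ r : Fin lam.natAbs, F (r : ℕ) ^ 2) *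
        ENNReal.ofReal
          (π * (Real.sqrt (2 * n + 1) / Real.sqrt (2 * π * |(lam : ℝ)|) + 1)) := by
    rw [tsum_int_eq_sum_tsum lam.natAbs, Finset.sum_mul]
    refine Finset.sum_le_sum fun r _ => ?_
    refine le_trans (le_of_eq ?_)
      (mul_le_mul_right (tsum_inv_hermiteWeight_le n hl ((r : ℕ) : ℤ) a) _)
    rw [← ENNReal.tsum_mul_left]
    refine tsum_congr fun m => ?_
    rw [hF, mul_pow, ← ENNReal.ofReal_pow (Real.sqrt_nonneg _), Real.sq_sqrt
      (inv_pos.2 (hw0 _)).le]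
  have h2 : ∑' k : ℤ, ENNReal.ofReal
      (Real.sqrt (w k) * |hermiteScaled n lam (k / (lam : ℝ) + a)|) ^ 2 ≤
      ENNReal.ofReal (2 * |(lam : ℝ)| +
        8 * (Real.sqrt (2 * π * |(lam : ℝ)|) * Real.sqrt (2 * n + 1))) := by
    refine le_trans (le_of_eq (tsum_congr fun k => ?_)) (tsum_weighted_hermiteScaled_le n hl a)
    rw [← ENNReal.ofReal_pow (by positivity), mul_pow, Real.sq_sqrt (hw0 k).le, sq_abs]
  refine (mul_le_mul' h1 h2).trans ?_
  rw [mul_assoc, mul_comm, ← ENNReal.ofReal_mul (by positivity)]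
  refine mul_le_mul_left (ENNReal.ofReal_le_ofReal ?_) _
  have hl0 : 0 < |(lam : ℝ)| := abs_pos.2 (Int.cast_ne_zero.2 hl)
  have hs0 : 0 < Real.sqrt (2 * π * |(lam : ℝ)|) := Real.sqrt_pos.2 (two_pi_abs_pos hl)
  have hs2 : Real.sqrt (2 * π * |(lam : ℝ)|) ^ 2 = 2 * π * |(lam : ℝ)| :=
    Real.sq_sqrt (two_pi_abs_pos hl).le
  have hN0 : (0 : ℝ) < 2 * n + 1 := by positivity
  have hr0 : 0 < Real.sqrt (2 * n + 1) := Real.sqrt_pos.2 hN0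
  have hrN : Real.sqrt (2 * n + 1) ^ 2 = 2 * n + 1 := Real.sq_sqrt hN0.le
  generalize Real.sqrt (2 * n + 1) = t at *
  generalize Real.sqrt (2 * π * |(lam : ℝ)|) = s at *
  generalize |(lam : ℝ)| = L at *
  rw [← hrN]
  have hLs : π * (t / s) * (2 * L) = s * t := by
    field_simp
    linarith
  have hpi := Real.pi_gt_three
  have hpi4 := Real.pi_le_four
  have hst : 2 * (s * t) ≤ 8 * L + t ^ 2 := by nlinarith [sq_nonneg (s - t)]
  have e : π * (t / s + 1) * (2 * L + 8 * (s * t)) =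
        s * t + π * (8 * t ^ 2 + 2 * L + 8 * (s * t)) := by
    have : t / s * (s * t) = t ^ 2 := by field_simp
    linear_combination hLs + 8 * π * this
  rw [e]
  nlinarith [mul_nonneg (sub_nonneg.2 hpi4) (by positivity : 0 ≤ 8 * t ^ 2 + 2 * L + 8 * (s * t))]

theorem tsum_setLIntegral_Icc_int_add {g : ℝ → ENNReal} (hg : Measurable g) (y : ℝ) :
    ∑' m : ℤ, ∫⁻ a in Set.Icc (0 : ℝ) 1, g (m + y + a) = ∫⁻ u, g u := by
  have h := lintegral_iUnion (μ := volume)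
      (s := fun n : ℤ => Set.Ioc (y + n • (1 : ℝ)) (y + (n + 1) • (1 : ℝ)))
    (fun _ => measurableSet_Ioc) (Set.pairwise_disjoint_Ioc_add_zsmul y 1) g
  rw [iUnion_Ioc_add_zsmul one_pos, setLIntegral_univ] at h
  rw [h]
  refine tsum_congr fun m => ?_
  rw [setLIntegral_congr Ioc_ae_eq_Icc.symm]
  have h2 := (measurePreserving_add_left volume ((m : ℝ) + y)).setLIntegral_comp_preimage
    (measurableSet_Ioc (a := y + m • (1 : ℝ)) (b := y + (m + 1) • (1 : ℝ))) hg
  rw [← h2]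
  congr 2
  ext x
  simp only [Set.mem_preimage, Set.mem_Ioc, zsmul_eq_mul, mul_one, Int.cast_add, Int.cast_one]
  constructor <;> rintro ⟨h1, h2⟩ <;> constructor <;> linarith

theorem continuous_hermiteScaled (n : ℕ) (lam : ℤ) : Continuous (hermiteScaled n lam) := by
  unfold hermiteScaled
  exact continuous_const.mul ((continuous_hermiteFun n).comp (by fun_prop))

theorem lintegral_hermiteScaled_sq (n : ℕ) {lam : ℤ} (hl : lam ≠ 0) :
    ∫⁻ u, ENNReal.ofReal (hermiteScaled n lam u ^ 2) = 1 := by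
  have hs0 : 0 < Real.sqrt (2 * π * |(lam : ℝ)|) := Real.sqrt_pos.2 (two_pi_abs_pos hl)
  rw [← ofReal_integral_eq_lintegral_ofReal _ (Filter.Eventually.of_forall fun _ => sq_nonneg _)]
  · simp only [hermiteScaled_sq n hl]
    generalize Real.sqrt (2 * π * |(lam : ℝ)|) = s at *
    rw [integral_const_mul, Measure.integral_comp_mul_left (fun u => hermiteFun n u ^ 2),
      integral_hermiteFun_sq, abs_of_pos (inv_pos.2 hs0)]
    simp [hs0.ne']
  · simp only [hermiteScaled_sq n hl]
    exact ((integrable_hermiteFun_sq n).comp_mul_left' hs0.ne').const_mul _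

theorem lintegral_tsum_periodic_mul_hermiteScaled_sq (n : ℕ) {lam : ℤ} (hl : lam ≠ 0)
    {F : ℤ → ENNReal} (hF : ∀ m r : ℤ, F (m * lam.natAbs + r) = F r) :
    ∫⁻ a in Set.Icc (0 : ℝ) 1, ∑' k : ℤ, F k ^ 2 *
        ENNReal.ofReal (hermiteScaled n lam (k / (lam : ℝ) + a) ^ 2) =
      ∑ r : Fin lam.natAbs, F (r : ℕ) ^ 2 := by
  have : NeZero lam.natAbs := ⟨Int.natAbs_ne_zero.2 hl⟩
  have hl0 : (lam : ℝ) ≠ 0 := Int.cast_ne_zero.2 hl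
  have hmeas : Measurable fun u => ENNReal.ofReal (hermiteScaled n lam u ^ 2) :=
    ((continuous_hermiteScaled n lam).pow 2).measurable.ennreal_ofReal
  have hmeas' : ∀ k : ℤ, Measurable fun a => F k ^ 2 *
      ENNReal.ofReal (hermiteScaled n lam (k / (lam : ℝ) + a) ^ 2) :=
    fun k => (hmeas.comp (measurable_const_add _)).const_mul _
  rw [lintegral_tsum fun k => (hmeas' k).aemeasurable,
    tsum_int_eq_sum_tsum lam.natAbs]
  refine Finset.sum_congr rfl fun r _ => ?_
  simp only [hF]
  have hc : ∀ m : ℤ, ∫⁻ a in Set.Icc (0 : ℝ) 1, F (r : ℕ) ^ 2 * ENNReal.ofReal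
      (hermiteScaled n lam (((m * lam.natAbs + (r : ℕ) : ℤ) : ℝ) / (lam : ℝ) + a) ^ 2) =
      F (r : ℕ) ^ 2 * ∫⁻ a in Set.Icc (0 : ℝ) 1, ENNReal.ofReal
      (hermiteScaled n lam (((m * lam.natAbs + (r : ℕ) : ℤ) : ℝ) / (lam : ℝ) + a) ^ 2) :=
    fun m => lintegral_const_mul _ (hmeas.comp (measurable_const_add _))
  simp only [hc]
  rw [ENNReal.tsum_mul_left]
  conv_rhs => rw [← mul_one (F (r : ℕ) ^ 2), ← lintegral_hermiteScaled_sq n hl,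
    ← tsum_setLIntegral_Icc_int_add hmeas ((r : ℕ) / (lam : ℝ))]
  congr 1
  rcases Int.natAbs_eq lam with hh | hh
  · refine tsum_congr fun m => ?_
    have h1 : ((lam.natAbs : ℤ) : ℝ) = lam := by rw [← hh]
    push_cast at h1 ⊢
    simp only [h1, add_div, mul_div_cancel_right₀ _ hl0]
  · rw [← (Equiv.neg ℤ).tsum_eq]
    refine tsum_congr fun m => ?_
    have h1 : ((lam.natAbs : ℤ) : ℝ) = -lam := by
      conv_rhs => rw [hh]
      simp
    push_cast at h1 ⊢
    simp only [Equiv.neg_apply, Int.cast_neg, h1, neg_mul_neg, add_div,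
      mul_div_cancel_right₀ _ hl0]
/-- The additive character `t ↦ e^{2πit}` of the real line. -/
noncomputable def charE (t : ℝ) : ℂ := Complex.exp (2 * π * t * Complex.I)

theorem charE_add (s t : ℝ) : charE (s + t) = charE s * charE t := by
  rw [charE, charE, charE, ← Complex.exp_add]; push_cast; ring_nf

theorem norm_charE (t : ℝ) : ‖charE t‖ = 1 := by
  have := Complex.norm_exp_ofReal_mul_I (2 * π * t)
  push_cast at this
  exact this

theorem charE_int (m : ℤ) : charE m = 1 :=
  Complex.exp_eq_one_iff.2 ⟨m, by push_cast; ring⟩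

theorem charE_zero : charE 0 = 1 := by simp [charE]

theorem charE_nat_mul (n : ℕ) (t : ℝ) : charE (n * t) = charE t ^ n := by
  rw [charE, charE, ← Complex.exp_nat_mul]; push_cast; ring_nf

theorem conj_charE (t : ℝ) : conj (charE t) = charE (-t) := by
  rw [charE, charE, ← Complex.exp_conj]
  simp [map_ofNat]

theorem continuous_charE : Continuous charE := by unfold charE; fun_prop

theorem charE_eq_one_iff {t : ℝ} : charE t = 1 ↔ ∃ m : ℤ, t = m := by
  constructor
  · intro h
    obtain ⟨m, hm⟩ := Complex.exp_eq_one_iff.1 h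
    refine ⟨m, ?_⟩
    have h2 : (2 * π * Complex.I) ≠ 0 := Complex.two_pi_I_ne_zero
    have h3 : (2 * π * Complex.I) * (t : ℂ) = (2 * π * Complex.I) * m := by linear_combination hm
    exact_mod_cast mul_left_cancel₀ h2 h3
  · rintro ⟨m, rfl⟩
    exact charE_int m

theorem integral_charE_int_mul (m : ℤ) :
    ∫ b in Set.Icc (0 : ℝ) 1, charE (m * b) = if m = 0 then 1 else 0 := by
  rw [integral_Icc_eq_integral_Ioc, ← intervalIntegral.integral_of_le zero_le_one]
  split_ifs with h
  · simp [h, charE_zero]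
  · have hc : (2 * π * Complex.I * m : ℂ) ≠ 0 :=
      mul_ne_zero Complex.two_pi_I_ne_zero (Int.cast_ne_zero.2 h)
    have e : ∀ b : ℝ, charE (m * b) = Complex.exp ((2 * π * Complex.I * m : ℂ) * b) := by
      intro b; rw [charE]; push_cast; ring_nf
    simp only [e]
    rw [integral_exp_mul_complex hc]
    have h1 : Complex.exp ((2 * π * Complex.I * m : ℂ) * (1 : ℝ)) = 1 :=
      Complex.exp_eq_one_iff.2 ⟨m, by push_cast; ring⟩
    rw [h1]
    simp

/-- Parseval's identity for absolutely convergent trigonometric series. -/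
theorem lintegral_enorm_trig_series_sq {ι : Type*} [Countable ι] {u : ι → ℂ}
    (hu : Summable fun i => ‖u i‖) {φ : ι → ℤ} (hφ : Function.Injective φ) :
    ∫⁻ b in Set.Icc (0 : ℝ) 1, ‖∑' i, u i * charE (φ i * b)‖ₑ ^ 2 = ∑' i, ‖u i‖ₑ ^ 2 := by
  set g : ℝ → ℂ := fun b => ∑' i, u i * charE (φ i * b) with hg
  have hcont : Continuous g := by
    refine continuous_tsum (fun i => continuous_const.mul (continuous_charE.comp (by fun_prop)))
      hu fun i b => ?_
    rw [norm_mul, norm_charE, mul_one]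
  have hu2 : Summable fun i => ‖u i‖ ^ 2 := by
    simpa [pow_two, Function.comp_def] using (hu.mul_norm hu).comp_injective
      (i := fun i : ι => (i, i)) fun i j h => (Prod.mk.inj h).1
  have hnorm : ∀ b (p : ι × ι), ‖u p.1 * charE (φ p.1 * b) * conj (u p.2 * charE (φ p.2 * b))‖ =
      ‖u p.1‖ * ‖u p.2‖ := by
    intro b p
    simp [norm_charE]
  have hprod : Summable fun p : ι × ι => ‖u p.1‖ * ‖u p.2‖ := by
    simpa using hu.mul_norm hu
  have hsq : ∀ b, ((‖g b‖ ^ 2 : ℝ) : ℂ) =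
      ∑' p : ι × ι, u p.1 * charE (φ p.1 * b) * conj (u p.2 * charE (φ p.2 * b)) := by
    intro b
    have hs : Summable fun i => ‖u i * charE (φ i * b)‖ := by
      simpa [norm_charE] using hu
    have hs' : Summable fun i => ‖conj (u i * charE (φ i * b))‖ := by
      simpa [norm_charE] using hu
    rw [← tsum_mul_tsum_of_summable_norm hs hs', ← Complex.conj_tsum, Complex.mul_conj,
      Complex.normSq_eq_norm_sq]
  have hterm : ∀ p : ι × ι, ∫ b in Set.Icc (0 : ℝ) 1,
      u p.1 * charE (φ p.1 * b) * conj (u p.2 * charE (φ p.2 * b)) =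
      if p.1 = p.2 then ((‖u p.1‖ ^ 2 : ℝ) : ℂ) else 0 := by
    rintro ⟨i, j⟩
    have e : ∀ b : ℝ, u i * charE (φ i * b) * conj (u j * charE (φ j * b)) =
        u i * conj (u j) * charE ((φ i - φ j : ℤ) * b) := by
      intro b
      have : ((φ i - φ j : ℤ) : ℝ) * b = φ i * b + -(φ j * b) := by push_cast; ring
      rw [this, charE_add, map_mul, conj_charE]
      ring
    simp only [e]
    rw [integral_const_mul, integral_charE_int_mul]
    by_cases hij : i = j
    · subst hij
      simp [Complex.mul_conj, Complex.normSq_eq_norm_sq]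
    · have : φ i - φ j ≠ 0 := fun h => hij (hφ (sub_eq_zero.1 h))
      simp [hij, this]
  have hint : ∫ b in Set.Icc (0 : ℝ) 1, ‖g b‖ ^ 2 = ∑' i, ‖u i‖ ^ 2 := by
    have h1 : ((∫ b in Set.Icc (0 : ℝ) 1, ‖g b‖ ^ 2 : ℝ) : ℂ) = ((∑' i, ‖u i‖ ^ 2 : ℝ) : ℂ) := by
      rw [← integral_complex_ofReal]
      simp only [hsq]
      rw [← integral_tsum_of_summable_integral_norm]
      · simp only [hterm]
        rw [Complex.ofReal_tsum]
        have hinj : Function.Injective fun i : ι => (i, i) := fun i j h => (Prod.mk.inj h).1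
        rw [← hinj.tsum_eq]
        · simp
        · rintro ⟨i, j⟩ hp
          rw [Function.mem_support] at hp
          by_cases hij : i = j
          · exact ⟨i, by rw [hij]⟩
          · simp [hij] at hp
      · intro p
        refine Continuous.integrableOn_Icc ?_
        exact (continuous_const.mul (continuous_charE.comp (by fun_prop))).mul
          (Complex.continuous_conj.comp
            (continuous_const.mul (continuous_charE.comp (by fun_prop))))
      · simp only [hnorm]
        simpa using hprod
    exact_mod_cast h1
  have h2 : ∀ z : ℂ, ‖z‖ₑ ^ 2 = ENNReal.ofReal (‖z‖ ^ 2) := fun z => by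
    rw [← ofReal_norm, ENNReal.ofReal_pow (norm_nonneg _)]
  simp only [h2]
  have hci : IntegrableOn (fun b => ‖g b‖ ^ 2) (Set.Icc 0 1) :=
    Continuous.integrableOn_Icc (by fun_prop)
  rw [← ENNReal.ofReal_tsum_of_nonneg (fun i => sq_nonneg _) hu2, ← hint,
    ofReal_integral_eq_lintegral_ofReal hci
      (Filter.Eventually.of_forall fun _ => sq_nonneg _)]

/-- Fourier coefficients of a combination of the functions `h_{λ,q,ℓ}` over `q`. -/
noncomputable def bwzCoeff (lam : ℤ) [NeZero lam.natAbs] (g : ZMod lam.natAbs → ℂ) (k : ℤ) : ℂ :=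
  ((Real.sqrt |(lam : ℝ)| / lam : ℝ) : ℂ) * ∑ q, g q * charE (-((q.val : ℝ) * k) / lam)

theorem bwzCoeff_periodic {lam : ℤ} [NeZero lam.natAbs] (g : ZMod lam.natAbs → ℂ) (m r : ℤ) :
    bwzCoeff lam g (m * lam.natAbs + r) = bwzCoeff lam g r := by
  have hl : (lam : ℝ) ≠ 0 := by
    have : lam ≠ 0 := Int.natAbs_ne_zero.1 (NeZero.ne _)
    exact_mod_cast this
  unfold bwzCoeff
  congr 1
  refine Finset.sum_congr rfl fun q _ => ?_
  congr 1
  obtain ⟨t, ht⟩ : lam ∣ lam.natAbs := Int.dvd_natAbs_self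
  have e : -((q.val : ℝ) * ((m * lam.natAbs + r : ℤ) : ℝ)) / lam =
      ((-(q.val * m * t) : ℤ) : ℝ) + -((q.val : ℝ) * r) / lam := by
    have : ((lam.natAbs : ℤ) : ℝ) = lam * t := by rw [ht]; push_cast; ring
    push_cast at this ⊢
    rw [this]
    field_simp
    ring
  rw [e, charE_add, charE_int, one_mul]

theorem sum_charE_sub_mul_div {lam : ℤ} [NeZero lam.natAbs] (q q' : ZMod lam.natAbs) :
    ∑ r : Fin lam.natAbs, charE (-((q.val : ℝ) * (r : ℕ)) / lam) *
      conj (charE (-((q'.val : ℝ) * (r : ℕ)) / lam)) =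
      if q = q' then (lam.natAbs : ℂ) else 0 := by
  have hl : (lam : ℝ) ≠ 0 := by
    have : lam ≠ 0 := Int.natAbs_ne_zero.1 (NeZero.ne _)
    exact_mod_cast this
  set z : ℂ := charE (((q'.val : ℝ) - q.val) / lam) with hz
  have e : ∀ r : ℕ, charE (-((q.val : ℝ) * r) / lam) *
      conj (charE (-((q'.val : ℝ) * r) / lam)) = z ^ r := by
    intro r
    rw [conj_charE, ← charE_add, hz, ← charE_nat_mul]
    congr 1; ring
  simp only [e]
  rw [Fin.sum_univ_eq_sum_range (fun r => z ^ r)]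
  split_ifs with h
  · have : z = 1 := by rw [hz, h, sub_self, zero_div, charE_zero]
    simp [this]
  · have hz1 : z ≠ 1 := by
      intro h1
      obtain ⟨m, hm⟩ := charE_eq_one_iff.1 h1
      rw [div_eq_iff hl] at hm
      have hm' : (q'.val : ℤ) - q.val = m * lam := by exact_mod_cast hm
      apply h
      have h3 : ((q'.val : ℤ) : ZMod lam.natAbs) = ((q.val : ℤ) : ZMod lam.natAbs) := by
        rw [ZMod.intCast_eq_intCast_iff_dvd_sub]
        exact Int.natAbs_dvd.2 ⟨-m, by linear_combination -hm'⟩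
      simpa using h3.symm
    have hzd : z ^ lam.natAbs = 1 := by
      rw [hz, ← charE_nat_mul]
      obtain ⟨t, ht⟩ : lam ∣ lam.natAbs := Int.dvd_natAbs_self
      have h4 : (lam.natAbs : ℝ) * (((q'.val : ℝ) - q.val) / lam) =
          ((t * (q'.val - q.val) : ℤ) : ℝ) := by
        have : (lam.natAbs : ℝ) = lam * t := by
          rw [← Int.cast_natCast, ht]; push_cast; ring
        rw [this]
        push_cast
        field_simp
      rw [h4, charE_int]
    rw [geom_sum_eq hz1, hzd, sub_self, zero_div]

theorem sum_norm_bwzCoeff_sq {lam : ℤ} [NeZero lam.natAbs] (g : ZMod lam.natAbs → ℂ) :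
    ∑ r : Fin lam.natAbs, ‖bwzCoeff lam g (r : ℕ)‖ ^ 2 = ∑ q, ‖g q‖ ^ 2 := by
  have hl : lam ≠ 0 := Int.natAbs_ne_zero.1 (NeZero.ne _)
  have hl0 : 0 < |(lam : ℝ)| := abs_pos.2 (Int.cast_ne_zero.2 hl)
  have hnorm : ∀ z : ℂ, ((‖z‖ ^ 2 : ℝ) : ℂ) = z * conj z := fun z => by
    rw [Complex.mul_conj, Complex.normSq_eq_norm_sq]
  have h1 : ((∑ r : Fin lam.natAbs,
      ‖∑ q, g q * charE (-((q.val : ℝ) * (r : ℕ)) / lam)‖ ^ 2 : ℝ) : ℂ) =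
      ((lam.natAbs * ∑ q, ‖g q‖ ^ 2 : ℝ) : ℂ) := by
    rw [Complex.ofReal_sum]
    simp only [hnorm, map_sum, Finset.sum_mul_sum]
    rw [Finset.sum_comm]
    have e : ∀ q : ZMod lam.natAbs, ∑ r : Fin lam.natAbs, ∑ q' : ZMod lam.natAbs,
        g q * charE (-((q.val : ℝ) * (r : ℕ)) / lam) *
          conj (g q' * charE (-((q'.val : ℝ) * (r : ℕ)) / lam)) =
        (lam.natAbs : ℂ) * (g q * conj (g q)) := by
      intro q
      rw [Finset.sum_comm]
      have e2 : ∀ q' : ZMod lam.natAbs, ∑ r : Fin lam.natAbs,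
          g q * charE (-((q.val : ℝ) * (r : ℕ)) / lam) *
            conj (g q' * charE (-((q'.val : ℝ) * (r : ℕ)) / lam)) =
          if q = q' then (lam.natAbs : ℂ) * (g q * conj (g q')) else 0 := by
        intro q'
        have := sum_charE_sub_mul_div q q'
        calc _ = g q * conj (g q') * ∑ r : Fin lam.natAbs,
              charE (-((q.val : ℝ) * (r : ℕ)) / lam) *
                conj (charE (-((q'.val : ℝ) * (r : ℕ)) / lam)) := by
              rw [Finset.mul_sum]
              refine Finset.sum_congr rfl fun r _ => ?_
              rw [map_mul]; ring
          _ = _ := by rw [this]; split_ifs <;> ring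
      simp only [e2, Finset.sum_ite_eq, Finset.mem_univ, if_true]
    simp only [e, Complex.ofReal_mul, Complex.ofReal_sum, hnorm, Finset.mul_sum,
      Complex.ofReal_natCast]
  have h2 : ∑ r : Fin lam.natAbs,
      ‖∑ q, g q * charE (-((q.val : ℝ) * (r : ℕ)) / lam)‖ ^ 2 = lam.natAbs * ∑ q, ‖g q‖ ^ 2 := by
    exact_mod_cast h1
  have h3 : (Real.sqrt |(lam : ℝ)| / |(lam : ℝ)|) ^ 2 * |(lam : ℝ)| = 1 := by
    rw [div_pow, Real.sq_sqrt hl0.le]; field_simp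
  simp only [bwzCoeff, norm_mul, mul_pow, Int.cast_natCast]
  rw [← Finset.mul_sum, h2, Complex.norm_real, norm_div, Real.norm_eq_abs, Real.norm_eq_abs,
    abs_of_nonneg (Real.sqrt_nonneg _), Nat.cast_natAbs, Int.cast_abs, ← mul_assoc, h3, one_mul]
/-- The Zak-type series of a Hermite function with coefficients `F`. -/
noncomputable def zakSeries (n : ℕ) (lam : ℤ) (F : ℤ → ℂ) (a b : ℝ) : ℂ :=
  ∑' k : ℤ, F k * (hermiteScaled n lam (k / (lam : ℝ) + a) : ℂ) * charE (k * b)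

theorem enorm_mul_hermiteScaled (z : ℂ) (x : ℝ) :
    ‖z * (x : ℂ)‖ₑ = ‖z‖ₑ * ENNReal.ofReal |x| := by
  rw [enorm_mul, ← ofReal_norm (x : ℂ), Complex.norm_real, Real.norm_eq_abs]

theorem summable_periodic_mul_hermiteScaled (n : ℕ) {lam : ℤ} (hl : lam ≠ 0) {F : ℤ → ℂ}
    (hF : ∀ m r : ℤ, F (m * lam.natAbs + r) = F r) (a : ℝ) :
    Summable fun k : ℤ => ‖F k * (hermiteScaled n lam (k / (lam : ℝ) + a) : ℂ)‖ := by
  have h := tsum_periodic_mul_hermiteScaled_sq_le n hl (F := fun k => ‖F k‖ₑ)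
    (fun m r => by rw [hF]) a
  have hfin : (∑' k : ℤ,
      ‖F k‖ₑ * ENNReal.ofReal |hermiteScaled n lam (k / (lam : ℝ) + a)|) ≠ ⊤ := by
    intro htop
    rw [htop] at h
    have h2 : ENNReal.ofReal (152 * (|(lam : ℝ)| + (2 * n + 1))) *
        ∑ r : Fin lam.natAbs, ‖F (r : ℕ)‖ₑ ^ 2 ≠ ⊤ :=
      ENNReal.mul_ne_top ENNReal.ofReal_ne_top
        (ENNReal.sum_ne_top.2 fun r _ => ENNReal.pow_ne_top enorm_ne_top)
    exact h2 (top_le_iff.1 (by simpa using h))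
  simp only [← enorm_mul_hermiteScaled] at hfin
  have := ENNReal.summable_toReal hfin
  simpa only [toReal_enorm] using this

theorem enorm_zakSeries_sq_le (n : ℕ) {lam : ℤ} (hl : lam ≠ 0) {F : ℤ → ℂ}
    (hF : ∀ m r : ℤ, F (m * lam.natAbs + r) = F r) (a b : ℝ) :
    ‖zakSeries n lam F a b‖ₑ ^ 2 ≤ ENNReal.ofReal (152 * (|(lam : ℝ)| + (2 * n + 1))) *
      ∑ r : Fin lam.natAbs, ‖F (r : ℕ)‖ₑ ^ 2 := by
  refine le_trans (pow_le_pow_left' (enorm_tsum_le_tsum_enorm.trans (le_of_eq ?_)) 2)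
    (tsum_periodic_mul_hermiteScaled_sq_le n hl (F := fun k => ‖F k‖ₑ) (fun m r => by rw [hF]) a)
  refine tsum_congr fun k => ?_
  rw [enorm_mul, enorm_mul_hermiteScaled, ← ofReal_norm (charE _), norm_charE,
    ENNReal.ofReal_one, mul_one]

theorem continuous_zakSeries (n : ℕ) {lam : ℤ} (hl : lam ≠ 0) {F : ℤ → ℂ}
    (hF : ∀ m r : ℤ, F (m * lam.natAbs + r) = F r) (a : ℝ) :
    Continuous (zakSeries n lam F a) := by
  refine continuous_tsum (fun k => continuous_const.mul (continuous_charE.comp (by fun_prop)))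
    (summable_periodic_mul_hermiteScaled n hl hF a) fun k b => ?_
  rw [norm_mul, norm_charE, mul_one]

theorem lintegral_enorm_zakSeries_sq (n : ℕ) {lam : ℤ} (hl : lam ≠ 0) {F : ℤ → ℂ}
    (hF : ∀ m r : ℤ, F (m * lam.natAbs + r) = F r) (a : ℝ) :
    ∫⁻ b in Set.Icc (0 : ℝ) 1, ‖zakSeries n lam F a b‖ₑ ^ 2 =
      ∑' k : ℤ, ‖F k‖ₑ ^ 2 * ENNReal.ofReal (hermiteScaled n lam (k / (lam : ℝ) + a) ^ 2) := by
  have h := lintegral_enorm_trig_series_sq (summable_periodic_mul_hermiteScaled n hl hF a)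
    (φ := id) Function.injective_id
  simp only [id] at h
  refine h.trans (tsum_congr fun k => ?_)
  rw [enorm_mul_hermiteScaled, mul_pow, ← ENNReal.ofReal_pow (abs_nonneg _), sq_abs]

theorem sum_mul_tsum_swap {ι κ : Type*} [Fintype ι] (g : ι → ℂ) {x : ι → κ → ℂ} {y z : κ → ℂ}
    (C e : ℂ) (h : ∀ i, Summable fun k => x i k * y k * z k) :
    ∑ i, g i * (C * ∑' k, e * (x i k * y k * z k)) =
      (∑' k, (C * ∑ i, g i * x i k) * y k * z k) * e := by
  have h1 : ∀ k, (C * ∑ i, g i * x i k) * y k * z k =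
      ∑ i, (C * g i) * (x i k * y k * z k) := fun k => by
    rw [Finset.mul_sum, Finset.sum_mul, Finset.sum_mul]
    exact Finset.sum_congr rfl fun i _ => by ring
  simp only [h1]
  rw [Summable.tsum_finsetSum fun i _ => (h i).mul_left _, Finset.sum_mul]
  refine Finset.sum_congr rfl fun i _ => ?_
  rw [tsum_mul_left, tsum_mul_left]; ring

theorem sum_mul_hBWZ_eq (n : ℕ) {lam : ℤ} [NeZero lam.natAbs] (g : ZMod lam.natAbs → ℂ)
    (a b c : ℝ) :
    ∑ q, g q * hBWZ lam (q.val : ℤ) n (a, b, c) =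
      zakSeries n lam (bwzCoeff lam g) a b * charE (lam * c) := by
  have hl : lam ≠ 0 := Int.natAbs_ne_zero.1 (NeZero.ne _)
  have hterm : ∀ (q : ZMod lam.natAbs) (k : ℤ),
      Complex.exp (-(2 * (π : ℂ) * Complex.I * ((q.val : ℤ) : ℂ) * (k : ℂ)) / (lam : ℂ)) *
        Complex.exp (2 * (π : ℂ) * Complex.I * ((lam : ℂ) * (c : ℂ) + (k : ℂ) * (b : ℂ))) *
        (hermiteScaled n lam ((k : ℝ) / (lam : ℝ) + a) : ℂ) =
      charE (lam * c) * (charE (-((q.val : ℝ) * k) / lam) *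
        (hermiteScaled n lam ((k : ℝ) / (lam : ℝ) + a) : ℂ) * charE (k * b)) := by
    intro q k
    have e1 : Complex.exp (-(2 * (π : ℂ) * Complex.I * ((q.val : ℤ) : ℂ) * (k : ℂ)) / (lam : ℂ)) =
        charE (-((q.val : ℝ) * k) / lam) := by
      rw [charE]; push_cast; ring_nf
    have e2 : Complex.exp (2 * (π : ℂ) * Complex.I * ((lam : ℂ) * (c : ℂ) + (k : ℂ) * (b : ℂ))) =
        charE (lam * c) * charE (k * b) := by
      rw [← charE_add, charE]; push_cast; ring_nf
    rw [e1, e2]; ring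
  have hone := summable_periodic_mul_hermiteScaled n hl (F := fun _ => 1) (fun _ _ => rfl) a
  have hsum : ∀ q : ZMod lam.natAbs, Summable fun k : ℤ => charE (-((q.val : ℝ) * k) / lam) *
      (hermiteScaled n lam ((k : ℝ) / (lam : ℝ) + a) : ℂ) * charE (k * b) := by
    intro q
    refine Summable.of_norm (hone.congr fun k => ?_)
    rw [norm_mul, norm_mul, norm_mul, norm_charE, norm_charE, norm_one, mul_one]
  have hq : ∀ q : ZMod lam.natAbs, hBWZ lam (q.val : ℤ) n (a, b, c) =
      ((Real.sqrt |(lam : ℝ)| / (lam : ℝ) : ℝ) : ℂ) * ∑' k : ℤ, charE (lam * c) *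
        (charE (-((q.val : ℝ) * k) / lam) *
          (hermiteScaled n lam ((k : ℝ) / (lam : ℝ) + a) : ℂ) * charE (k * b)) := fun q => by
    rw [hBWZ, BWZ]
    exact congrArg _ (tsum_congr (hterm q))
  rw [Finset.sum_congr rfl fun q _ => congrArg (g q * ·) (hq q),
    sum_mul_tsum_swap g _ _ hsum, zakSeries]
  rfl

/-- The part of an eigenfunction at a fixed central frequency: factorisation, pointwise bound and
`L²` bound. -/
theorem exists_central_component (n : ℕ) {lam : ℤ} (hl : lam ≠ 0) (γ : ℤ → ℂ) :
    ∃ (A : ℝ → ℝ → ℂ) (J : ℝ → ENNReal),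
      (∀ a b c : ℝ, ∑' q : ZMod lam.natAbs, γ (q.val : ℤ) * hBWZ lam (q.val : ℤ) n (a, b, c) =
        A a b * charE (lam * c)) ∧
      (∀ a, Continuous (A a)) ∧ Measurable J ∧
      (∀ a b, ‖A a b‖ₑ ^ 2 ≤ ENNReal.ofReal (152 * (|(lam : ℝ)| + (2 * n + 1))) *
        ENNReal.ofReal (∑' q : ZMod lam.natAbs, ‖γ (q.val : ℤ)‖ ^ 2)) ∧
      (∀ a, ∫⁻ b in Set.Icc (0 : ℝ) 1, ‖A a b‖ₑ ^ 2 ≤ J a) ∧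
      ∫⁻ a in Set.Icc (0 : ℝ) 1, J a ≤
        ENNReal.ofReal (∑' q : ZMod lam.natAbs, ‖γ (q.val : ℤ)‖ ^ 2) := by
  have : NeZero lam.natAbs := ⟨Int.natAbs_ne_zero.2 hl⟩
  set g : ZMod lam.natAbs → ℂ := fun q => γ (q.val : ℤ) with hg
  have hF := bwzCoeff_periodic g
  have hE : ∑ r : Fin lam.natAbs, ‖bwzCoeff lam g (r : ℕ)‖ₑ ^ 2 =
      ENNReal.ofReal (∑' q : ZMod lam.natAbs, ‖γ (q.val : ℤ)‖ ^ 2) := by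
    rw [tsum_fintype, ← sum_norm_bwzCoeff_sq g, ENNReal.ofReal_sum_of_nonneg fun _ _ => sq_nonneg _]
    refine Finset.sum_congr rfl fun r _ => ?_
    rw [ENNReal.ofReal_pow (norm_nonneg _), ofReal_norm]
  refine ⟨zakSeries n lam (bwzCoeff lam g), fun a => ∑' k : ℤ, ‖bwzCoeff lam g k‖ₑ ^ 2 *
    ENNReal.ofReal (hermiteScaled n lam (k / (lam : ℝ) + a) ^ 2), fun a b c => ?_,
    continuous_zakSeries n hl hF, ?_, fun a b => ?_, fun a => ?_, ?_⟩
  · rw [tsum_fintype]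
    exact sum_mul_hBWZ_eq n g a b c
  · refine Measurable.tsum fun k => Measurable.const_mul ?_ _
    have := continuous_hermiteScaled n lam
    exact Measurable.ennreal_ofReal (Continuous.measurable (by fun_prop))
  · rw [← hE]
    exact enorm_zakSeries_sq_le n hl hF a b
  · exact (lintegral_enorm_zakSeries_sq n hl hF a).le
  · rw [← hE]
    exact (lintegral_tsum_periodic_mul_hermiteScaled_sq n hl
      (F := fun k => ‖bwzCoeff lam g k‖ₑ) fun m r => by rw [hF]).le

/-- `L⁴` bound for a sum of components with distinct central frequencies, by interpolating the
pointwise and the `L²` bounds. -/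
theorem lintegral_enorm_central_sum_pow_four_le {ι : Type*} [Fintype ι] {φ : ι → ℤ}
    (hφ : Function.Injective φ) {A : ι → ℝ → ℝ → ℂ} {J : ι → ℝ → ENNReal} {B E : ι → ENNReal}
    (hA : ∀ i a, Continuous (A i a)) (hJ : ∀ i, Measurable (J i))
    (hAB : ∀ i a b, ‖A i a b‖ₑ ^ 2 ≤ B i * E i)
    (hAJ : ∀ i a, ∫⁻ b in Set.Icc (0 : ℝ) 1, ‖A i a b‖ₑ ^ 2 ≤ J i a)
    (hJE : ∀ i, ∫⁻ a in Set.Icc (0 : ℝ) 1, J i a ≤ E i) :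
    ∫⁻ a in Set.Icc (0 : ℝ) 1, ∫⁻ b in Set.Icc (0 : ℝ) 1, ∫⁻ c in Set.Icc (0 : ℝ) 1,
        ‖∑ i, A i a b * charE (φ i * c)‖ₑ ^ 4 ≤ (∑ i, B i) * (∑ i, E i) ^ 2 := by
  set K : ENNReal := (∑ i, B i) * ∑ i, E i with hK
  have hsup : ∀ a b c, ‖∑ i, A i a b * charE (φ i * c)‖ₑ ^ 2 ≤ K := by
    intro a b c
    have h1 : ∀ i, ‖A i a b * charE (φ i * c)‖ₑ ≤ B i ^ (1 / 2 : ℝ) * E i ^ (1 / 2 : ℝ) := by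
      intro i
      rw [enorm_mul, ← ofReal_norm (charE _), norm_charE, ENNReal.ofReal_one, mul_one,
        ← ENNReal.mul_rpow_of_nonneg _ _ (by norm_num)]
      calc ‖A i a b‖ₑ = (‖A i a b‖ₑ ^ 2) ^ (1 / 2 : ℝ) := by
            rw [← ENNReal.rpow_natCast, ← ENNReal.rpow_mul]; norm_num
        _ ≤ _ := ENNReal.rpow_le_rpow (hAB i a b) (by norm_num)
    have h2 := ENNReal.tsum_mul_sq_le (fun i => B i ^ (1 / 2 : ℝ)) fun i => E i ^ (1 / 2 : ℝ)
    have h3 : ∀ x : ENNReal, (x ^ (1 / 2 : ℝ)) ^ 2 = x := fun x => by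
      rw [← ENNReal.rpow_natCast, ← ENNReal.rpow_mul]; norm_num
    simp only [tsum_fintype, h3] at h2
    exact (pow_le_pow_left' ((enorm_sum_le _ _).trans (Finset.sum_le_sum fun i _ => h1 i)) 2).trans
      h2
  have hc : ∀ a b, ∫⁻ c in Set.Icc (0 : ℝ) 1, ‖∑ i, A i a b * charE (φ i * c)‖ₑ ^ 4 ≤
      K * ∑ i, ‖A i a b‖ₑ ^ 2 := by
    intro a b
    have hp := lintegral_enorm_trig_series_sq (u := fun i => A i a b)
      (hasSum_fintype _).summable hφ
    simp only [tsum_fintype] at hp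
    rw [← hp, ← lintegral_const_mul _ (by
      have := continuous_charE
      exact (Continuous.enorm (by fun_prop)).measurable.pow_const 2)]
    refine lintegral_mono fun c => ?_
    rw [show (4 : ℕ) = 2 + 2 from rfl, pow_add]
    exact mul_le_mul_left (hsup a b c) _
  have hb : ∀ a, ∫⁻ b in Set.Icc (0 : ℝ) 1, ∫⁻ c in Set.Icc (0 : ℝ) 1,
      ‖∑ i, A i a b * charE (φ i * c)‖ₑ ^ 4 ≤ K * ∑ i, J i a := by
    intro a
    have hm : ∀ i, Measurable fun b => ‖A i a b‖ₑ ^ 2 := fun i =>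
      (hA i a).enorm.measurable.pow_const 2
    refine (lintegral_mono (hc a)).trans ?_
    rw [lintegral_const_mul _ (Finset.measurable_fun_sum _ fun i _ => hm i),
      lintegral_finsetSum _ fun i _ => hm i]
    exact mul_le_mul_right (Finset.sum_le_sum fun i _ => hAJ i a) _
  refine (lintegral_mono hb).trans ?_
  rw [lintegral_const_mul _ (Finset.measurable_fun_sum _ fun i _ => hJ i),
    lintegral_finsetSum _ fun i _ => hJ i]
  refine (mul_le_mul_right (Finset.sum_le_sum fun i _ => hJE i) _).trans (le_of_eq ?_)
  rw [hK]; ring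
theorem sum_le_sum_of_injOn {ι κ : Type*} {s : Finset ι} {t : Finset κ} {f : ι → ℝ} {g : κ → ℝ}
    (i : ι → κ) (hi : Set.InjOn i s) (hmem : ∀ p ∈ s, i p ∈ t) (hfg : ∀ p ∈ s, f p ≤ g (i p))
    (hg : ∀ k ∈ t, 0 ≤ g k) : ∑ p ∈ s, f p ≤ ∑ k ∈ t, g k := by
  refine (Finset.sum_le_sum hfg).trans ?_
  rw [← Finset.sum_image (f := g) hi]
  exact Finset.sum_le_sum_of_subset_of_nonneg (Finset.image_subset_iff.2 hmem)
    fun k hk _ => hg k hk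

theorem sum_Icc_bool_div_le (n : ℕ) :
    ∑ k ∈ Finset.Icc 1 n ×ˢ (Finset.univ : Finset Bool), (n : ℝ) / (k.1 : ℝ) ≤
      2 * (n * (1 + Real.log n)) := by
  have h := harmonic_le_one_add_log n
  rw [harmonic_eq_sum_Icc] at h
  push_cast at h
  rw [Finset.sum_product]
  simp only [Finset.sum_const, Finset.card_univ, Fintype.card_bool, nsmul_eq_mul, div_eq_mul_inv]
  rw [← Finset.mul_sum, ← Finset.mul_sum]
  push_cast
  gcongr

/-- The sum of `|λ| + (2ℓ + 1)` over the pairs with `|λ| (2ℓ + 1) = n`. -/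
theorem sum_natAbs_add_le {n : ℕ} (hn : 1 ≤ n) {s : Finset (ℤ × ℕ)}
    (hs : ∀ p ∈ s, p.1.natAbs * (2 * p.2 + 1) = n) :
    ∑ p ∈ s, (|(p.1 : ℝ)| + (2 * (p.2 : ℝ) + 1)) ≤ 4 * (n * (1 + Real.log n)) := by
  have habs : ∀ p ∈ s, |(p.1 : ℝ)| * (2 * (p.2 : ℝ) + 1) = n := fun p hp => by
    rw [← hs p hp]; push_cast; rw [Nat.cast_natAbs]; push_cast; rfl
  have hpos : ∀ p ∈ s, 0 < p.1.natAbs := fun p hp =>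
    Nat.pos_of_ne_zero fun h0 => by have := hs p hp; rw [h0] at this; omega
  have h1 : ∑ p ∈ s, |(p.1 : ℝ)| ≤ 2 * (n * (1 + Real.log n)) := by
    refine (sum_le_sum_of_injOn (fun p => (2 * p.2 + 1, decide (0 < p.1))) ?_ ?_ ?_ ?_).trans
      (sum_Icc_bool_div_le n)
    · rintro ⟨l, m⟩ hp ⟨l', m'⟩ hp' h
      have e1 := hs _ hp
      have e2 := hs _ hp'
      simp only [Prod.mk.injEq, decide_eq_decide] at h e1 e2 ⊢
      obtain rfl : m = m' := by omega
      have e3 := Nat.eq_of_mul_eq_mul_right (Nat.succ_pos _) (e1.trans e2.symm)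
      have := hpos _ hp
      simp only at this
      exact ⟨by omega, rfl⟩
    · intro p hp
      simp only [Finset.mem_product, Finset.mem_Icc, Finset.mem_univ, and_true]
      exact ⟨by omega, by rw [← hs p hp]; exact Nat.le_mul_of_pos_left _ (hpos p hp)⟩
    · intro p hp
      rw [le_div_iff₀ (by positivity)]
      push_cast
      exact (habs p hp).le
    · intro k _
      positivity
  have h2 : ∑ p ∈ s, (2 * (p.2 : ℝ) + 1) ≤ 2 * (n * (1 + Real.log n)) := by
    refine (sum_le_sum_of_injOn (fun p => (p.1.natAbs, decide (0 < p.1))) ?_ ?_ ?_ ?_).trans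
      (sum_Icc_bool_div_le n)
    · rintro ⟨l, m⟩ hp ⟨l', m'⟩ hp' h
      have e1 := hs _ hp
      have e2 := hs _ hp'
      simp only [Prod.mk.injEq, decide_eq_decide] at h e1 e2 ⊢
      rw [← h.1] at e2
      have e3 := Nat.eq_of_mul_eq_mul_left (hpos _ hp) (e1.trans e2.symm)
      have := hpos _ hp
      simp only at this
      exact ⟨by omega, by omega⟩
    · intro p hp
      simp only [Finset.mem_product, Finset.mem_Icc, Finset.mem_univ, and_true]
      exact ⟨hpos p hp, by rw [← hs p hp]; exact Nat.le_mul_of_pos_right _ (Nat.succ_pos _)⟩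
    · intro p hp
      have h0 : (0 : ℝ) < p.1.natAbs := by exact_mod_cast hpos p hp
      rw [le_div_iff₀ h0, ← habs p hp, Nat.cast_natAbs, mul_comm]
      push_cast
      rfl
    · intro k _
      positivity
  rw [Finset.sum_add_distrib]
  linarith

theorem finite_central_spectrum (μ : ℝ) :
    {p : ℤ × ℕ | p.1 ≠ 0 ∧ 2 * π * |(p.1 : ℝ)| * (2 * (p.2 : ℝ) + 1) = μ ^ 2}.Finite := by
  refine ((Set.finite_Icc (-⌊μ ^ 2⌋) ⌊μ ^ 2⌋).prod (Set.finite_Iic ⌊μ ^ 2⌋₊)).subset ?_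
  rintro ⟨l, m⟩ ⟨h0, h⟩
  simp only at h0 h
  have hl : (1 : ℝ) ≤ |(l : ℝ)| := by exact_mod_cast Int.one_le_abs h0
  have hm : (0 : ℝ) ≤ m := Nat.cast_nonneg _
  have hp : (1 : ℝ) ≤ 2 * π := by linarith [Real.pi_gt_three]
  have h1 : |(l : ℝ)| ≤ μ ^ 2 := by
    rw [← h]
    calc |(l : ℝ)| = 1 * |(l : ℝ)| * 1 := by ring
      _ ≤ _ := by gcongr; linarith
  have h2 : (m : ℝ) ≤ μ ^ 2 := by
    rw [← h]
    calc (m : ℝ) ≤ 1 * 1 * (2 * m + 1) := by linarith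
      _ ≤ _ := by gcongr
  have h3 : |l| ≤ ⌊μ ^ 2⌋ := Int.le_floor.2 (by push_cast; exact h1)
  exact ⟨abs_le.1 h3, Nat.le_floor h2⟩

theorem injOn_fst_central_spectrum (μ : ℝ) :
    Set.InjOn Prod.fst
      {p : ℤ × ℕ | p.1 ≠ 0 ∧ 2 * π * |(p.1 : ℝ)| * (2 * (p.2 : ℝ) + 1) = μ ^ 2} := by
  rintro ⟨l, m⟩ ⟨h0, h⟩ ⟨l', m'⟩ ⟨-, h'⟩ (rfl : l = l')
  have hl : |(l : ℝ)| ≠ 0 := abs_ne_zero.2 (Int.cast_ne_zero.2 h0)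
  have := mul_left_cancel₀ (mul_ne_zero (by positivity) hl) (h.trans h'.symm)
  simp only [Prod.mk.injEq, true_and]
  have h4 : (m : ℝ) = m' := by simp only at this; linarith
  exact_mod_cast h4

/-- Polynomially sharp count in the central part of the spectrum, from the logarithmic growth of
harmonic numbers. -/
theorem sum_central_spectrum_le {ε : ℝ} (hε : 0 < ε) {μ : ℝ} (hμ : 0 < μ) {s : Finset (ℤ × ℕ)}
    (hs : ∀ p ∈ s, p.1 ≠ 0 ∧ 2 * π * |(p.1 : ℝ)| * (2 * (p.2 : ℝ) + 1) = μ ^ 2) :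
    ∑ p ∈ s, (|(p.1 : ℝ)| + (2 * (p.2 : ℝ) + 1)) ≤
      4 * (1 + 1 / (2 * ε)) * μ ^ (2 + 4 * ε) := by
  rcases s.eq_empty_or_nonempty with rfl | ⟨p₀, hp₀⟩
  · rw [Finset.sum_empty]; positivity
  have hcast : ∀ p : ℤ × ℕ, ((p.1.natAbs * (2 * p.2 + 1) : ℕ) : ℝ) =
      |(p.1 : ℝ)| * (2 * (p.2 : ℝ) + 1) := fun p => by
    push_cast; rw [Nat.cast_natAbs]; push_cast; rfl
  set n := p₀.1.natAbs * (2 * p₀.2 + 1) with hn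
  have hnμ : 2 * π * n = μ ^ 2 := by rw [hn, hcast, ← (hs _ hp₀).2]; ring
  have hall : ∀ p ∈ s, p.1.natAbs * (2 * p.2 + 1) = n := fun p hp => by
    have h1 := (hs p hp).2
    rw [← hnμ, mul_assoc, ← hcast] at h1
    exact_mod_cast mul_left_cancel₀ (by positivity) h1
  have hn1 : 1 ≤ n := Nat.mul_pos (Int.natAbs_pos.2 (hs _ hp₀).1) (Nat.succ_pos _)
  have hn1' : (1 : ℝ) ≤ n := by exact_mod_cast hn1
  have hle : (n : ℝ) ≤ μ ^ 2 := by
    rw [← hnμ]; nlinarith [Real.pi_gt_three]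
  refine (sum_natAbs_add_le hn1 hall).trans ?_
  have hlog : Real.log n ≤ (n : ℝ) ^ (2 * ε) / (2 * ε) :=
    Real.log_le_rpow_div (Nat.cast_nonneg _) (by positivity)
  have hone : (1 : ℝ) ≤ (n : ℝ) ^ (2 * ε) := Real.one_le_rpow hn1' (by positivity)
  have hpow : (n : ℝ) * (n : ℝ) ^ (2 * ε) ≤ μ ^ (2 + 4 * ε) := by
    calc (n : ℝ) * (n : ℝ) ^ (2 * ε) ≤ μ ^ 2 * (μ ^ 2) ^ (2 * ε) := by gcongr
      _ = μ ^ (2 + 4 * ε) := by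
        rw [← Real.rpow_natCast, ← Real.rpow_mul hμ.le, ← Real.rpow_add hμ]
        push_cast; ring_nf
  calc 4 * ((n : ℝ) * (1 + Real.log n))
      ≤ 4 * (n * ((n : ℝ) ^ (2 * ε) + (n : ℝ) ^ (2 * ε) / (2 * ε))) := by gcongr
    _ = 4 * (1 + 1 / (2 * ε)) * (n * (n : ℝ) ^ (2 * ε)) := by ring
    _ ≤ _ := by gcongr

theorem abs_le_of_torus_spectrum {μ : ℝ} (hμ : 0 < μ) {ω : ℤ × ℤ}
    (h : 4 * π ^ 2 * ((ω.1 : ℝ) ^ 2 + (ω.2 : ℝ) ^ 2) = μ ^ 2) :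
    |ω.1| ≤ (⌊μ⌋₊ : ℤ) ∧ |ω.2| ≤ (⌊μ⌋₊ : ℤ) := by
  have hp : 1 ≤ 4 * π ^ 2 := by nlinarith [Real.pi_gt_three]
  have key : (ω.1 : ℝ) ^ 2 + (ω.2 : ℝ) ^ 2 ≤ μ ^ 2 := by
    rw [← h]; exact le_mul_of_one_le_left (by positivity) hp
  have h1 : |(ω.1 : ℝ)| ≤ μ := abs_le_of_sq_le_sq (by nlinarith [sq_nonneg (ω.2 : ℝ)]) hμ.le
  have h2 : |(ω.2 : ℝ)| ≤ μ := abs_le_of_sq_le_sq (by nlinarith [sq_nonneg (ω.1 : ℝ)]) hμ.le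
  rw [Int.natCast_floor_eq_floor hμ.le]
  exact ⟨Int.le_floor.2 (by push_cast; exact h1), Int.le_floor.2 (by push_cast; exact h2)⟩

theorem finite_torus_spectrum {μ : ℝ} (hμ : 0 < μ) :
    {ω : ℤ × ℤ | 4 * π ^ 2 * ((ω.1 : ℝ) ^ 2 + (ω.2 : ℝ) ^ 2) = μ ^ 2}.Finite := by
  refine ((Set.finite_Icc (-(⌊μ⌋₊ : ℤ)) ⌊μ⌋₊).prod
    (Set.finite_Icc (-(⌊μ⌋₊ : ℤ)) ⌊μ⌋₊)).subset fun ω h => ?_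
  have := abs_le_of_torus_spectrum hμ h
  exact ⟨abs_le.1 this.1, abs_le.1 this.2⟩

theorem card_torus_spectrum_le {ε : ℝ} (hε : 0 < ε) {μ : ℝ} (hμ : 0 < μ) {s : Finset (ℤ × ℤ)}
    (hs : ∀ ω ∈ s, 4 * π ^ 2 * ((ω.1 : ℝ) ^ 2 + (ω.2 : ℝ) ^ 2) = μ ^ 2) :
    (s.card : ℝ) ≤ 6 * μ ^ (1 + 2 * ε) := by
  rcases s.eq_empty_or_nonempty with rfl | ⟨ω₀, hω₀⟩
  · rw [Finset.card_empty, Nat.cast_zero]; positivity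
  have hμ1 : 1 ≤ μ := by
    by_contra! hlt
    have h := hs _ hω₀
    obtain ⟨h1, h2⟩ := abs_le_of_torus_spectrum hμ h
    rw [Nat.floor_eq_zero.2 hlt, Nat.cast_zero] at h1 h2
    rw [abs_nonpos_iff.1 h1, abs_nonpos_iff.1 h2] at h
    norm_num at h
    exact (pow_pos hμ 2).ne h
  have hcard : s.card ≤ ((Finset.Icc (-(⌊μ⌋₊ : ℤ)) ⌊μ⌋₊) ×ˢ
      (Finset.univ : Finset Bool)).card := by
    refine Finset.card_le_card_of_injOn (fun ω => (ω.1, decide (0 < ω.2))) ?_ ?_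
    · intro ω hω
      simp only [Finset.coe_product, Set.mem_prod, Finset.mem_coe, Finset.mem_Icc,
        Finset.mem_univ, and_true]
      exact abs_le.1 (abs_le_of_torus_spectrum hμ (hs ω hω)).1
    · rintro ⟨x, y⟩ hω ⟨x', y'⟩ hω' h
      have e1 := hs _ hω
      have e2 := hs _ hω'
      simp only [Prod.mk.injEq, decide_eq_decide] at h e1 e2 ⊢
      obtain ⟨rfl, hsgn⟩ := h
      have e3 := mul_left_cancel₀ (by positivity) (e1.trans e2.symm)
      have e4 : y ^ 2 = y' ^ 2 := by exact_mod_cast add_left_cancel e3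
      refine ⟨rfl, ?_⟩
      rcases sq_eq_sq_iff_eq_or_eq_neg.1 e4 with h | h <;> omega
  rw [Finset.card_product, Int.card_Icc, Finset.card_univ, Fintype.card_bool] at hcard
  have h1 : s.card ≤ 4 * ⌊μ⌋₊ + 2 := by omega
  have h2 : (s.card : ℝ) ≤ 4 * ⌊μ⌋₊ + 2 := by exact_mod_cast h1
  have h3 := Nat.floor_le hμ.le
  have h4 : μ ≤ μ ^ (1 + 2 * ε) := Real.self_le_rpow_of_one_le hμ1 (by linarith)
  linarith

theorem norm_torus_sum_pow_four_le {ι : Type*} (s : Finset ι) (u e : ι → ℂ) (he : ∀ i, ‖e i‖ = 1) :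
    ‖∑ i ∈ s, u i * e i‖ ^ 4 ≤ (s.card : ℝ) ^ 2 * (∑ i ∈ s, ‖u i‖ ^ 2) ^ 2 := by
  have h1 : ‖∑ i ∈ s, u i * e i‖ ≤ ∑ i ∈ s, ‖u i‖ := by
    refine (norm_sum_le _ _).trans (Finset.sum_le_sum fun i _ => ?_)
    rw [norm_mul, he, mul_one]
  have h2 : (∑ i ∈ s, ‖u i‖) ^ 2 ≤ s.card * ∑ i ∈ s, ‖u i‖ ^ 2 := sq_sum_le_card_mul_sum_sq
  calc ‖∑ i ∈ s, u i * e i‖ ^ 4 ≤ (∑ i ∈ s, ‖u i‖) ^ 4 := by gcongr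
    _ = ((∑ i ∈ s, ‖u i‖) ^ 2) ^ 2 := by ring
    _ ≤ (s.card * ∑ i ∈ s, ‖u i‖ ^ 2) ^ 2 := by gcongr
    _ = _ := by ring

/-- No measurability is needed: the left side vanishes for non-integrable functions. -/
theorem ofReal_integral_le_lintegral {α : Type*} [MeasurableSpace α] {ν : Measure α} {f : α → ℝ}
    (hf : ∀ x, 0 ≤ f x) : ENNReal.ofReal (∫ x, f x ∂ν) ≤ ∫⁻ x, ENNReal.ofReal (f x) ∂ν := by
  by_cases h : Integrable f ν
  · exact (ofReal_integral_eq_lintegral_ofReal h (Filter.Eventually.of_forall hf)).le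
  · rw [integral_undef h, ENNReal.ofReal_zero]
    exact zero_le

theorem ofReal_integral_cube_le {f : ℝ → ℝ → ℝ → ℝ} (hf : ∀ a b c, 0 ≤ f a b c) (s : Set ℝ) :
    ENNReal.ofReal (∫ a in s, ∫ b in s, ∫ c in s, f a b c) ≤
      ∫⁻ a in s, ∫⁻ b in s, ∫⁻ c in s, ENNReal.ofReal (f a b c) := by
  refine (ofReal_integral_le_lintegral fun a => integral_nonneg fun b => integral_nonneg fun c =>
    hf a b c).trans (lintegral_mono fun a => ?_)
  refine (ofReal_integral_le_lintegral fun b => integral_nonneg fun c =>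
    hf a b c).trans (lintegral_mono fun b => ?_)
  exact ofReal_integral_le_lintegral fun c => hf a b c

theorem lintegral_unit_const_add_mul {K M : ENNReal} (hM : M ≠ ⊤) (f : ℝ → ENNReal) :
    ∫⁻ x in Set.Icc (0 : ℝ) 1, (K + M * f x) = K + M * ∫⁻ x in Set.Icc (0 : ℝ) 1, f x := by
  rw [lintegral_add_left measurable_const, lintegral_const_mul' _ _ hM]
  simp

/-- The `L⁴` bound for the part of an eigenfunction with non-zero central frequencies. -/
theorem lintegral_enorm_central_pow_four_le {ε : ℝ} (hε : 0 < ε) {μ : ℝ} (hμ : 0 < μ)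
    {s : Finset (ℤ × ℕ)}
    (hs : ∀ p ∈ s, p.1 ≠ 0 ∧ 2 * π * |(p.1 : ℝ)| * (2 * (p.2 : ℝ) + 1) = μ ^ 2)
    (γ : ℤ → ℤ → ℕ → ℂ) :
    ∫⁻ a in Set.Icc (0 : ℝ) 1, ∫⁻ b in Set.Icc (0 : ℝ) 1, ∫⁻ c in Set.Icc (0 : ℝ) 1,
        ‖∑ p ∈ s, ∑' q : ZMod p.1.natAbs,
          γ p.1 (q.val : ℤ) p.2 * hBWZ p.1 (q.val : ℤ) p.2 (a, b, c)‖ₑ ^ 4 ≤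
      ENNReal.ofReal (608 * (1 + 1 / (2 * ε)) * μ ^ (2 + 4 * ε) *
        (∑ p ∈ s, ∑' q : ZMod p.1.natAbs, ‖γ p.1 (q.val : ℤ) p.2‖ ^ 2) ^ 2) := by
  choose A J hA hAc hJ hAB hAJ hJE using fun i : s =>
    exists_central_component i.1.2 (hs i.1 i.2).1 fun q => γ i.1.1 q i.1.2
  have hφ : Function.Injective fun i : s => i.1.1 := fun i j h =>
    Subtype.ext (injOn_fst_central_spectrum μ (hs _ i.2) (hs _ j.2) h)
  have main := lintegral_enorm_central_sum_pow_four_le hφ hAc hJ hAB hAJ hJE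
  simp only [← hA] at main
  have hE0 : ∀ p : ℤ × ℕ, 0 ≤ ∑' q : ZMod p.1.natAbs, ‖γ p.1 (q.val : ℤ) p.2‖ ^ 2 :=
    fun p => tsum_nonneg fun q => sq_nonneg _
  have hsumE : ∑ i : s, ENNReal.ofReal
      (∑' q : ZMod i.1.1.natAbs, ‖γ i.1.1 (q.val : ℤ) i.1.2‖ ^ 2) =
      ENNReal.ofReal (∑ p ∈ s, ∑' q : ZMod p.1.natAbs, ‖γ p.1 (q.val : ℤ) p.2‖ ^ 2) := by
    rw [ENNReal.ofReal_sum_of_nonneg fun p _ => hE0 p, ← Finset.sum_coe_sort s]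
  have hsumB : ∑ i : s, ENNReal.ofReal (152 * (|(i.1.1 : ℝ)| + (2 * (i.1.2 : ℝ) + 1))) ≤
      ENNReal.ofReal (608 * (1 + 1 / (2 * ε)) * μ ^ (2 + 4 * ε)) := by
    rw [← ENNReal.ofReal_sum_of_nonneg fun i _ => by positivity,
      Finset.sum_coe_sort s fun p => 152 * (|(p.1 : ℝ)| + (2 * (p.2 : ℝ) + 1)), ← Finset.mul_sum]
    refine ENNReal.ofReal_le_ofReal ?_
    linarith [sum_central_spectrum_le hε hμ hs]
  have hlhs : ∀ a b c : ℝ, ∑ i : s, ∑' q : ZMod i.1.1.natAbs,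
      γ i.1.1 (q.val : ℤ) i.1.2 * hBWZ i.1.1 (q.val : ℤ) i.1.2 (a, b, c) =
      ∑ p ∈ s, ∑' q : ZMod p.1.natAbs,
        γ p.1 (q.val : ℤ) p.2 * hBWZ p.1 (q.val : ℤ) p.2 (a, b, c) := fun a b c =>
    Finset.sum_coe_sort s fun p => ∑' q : ZMod p.1.natAbs,
      γ p.1 (q.val : ℤ) p.2 * hBWZ p.1 (q.val : ℤ) p.2 (a, b, c)
  simp only [hlhs] at main
  refine main.trans ?_
  rw [hsumE, ENNReal.ofReal_mul (by positivity), ENNReal.ofReal_pow (Finset.sum_nonneg fun p _ =>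
    hE0 p)]
  exact mul_le_mul_left hsumB _

theorem tsum_ite_eq_sum_toFinset {α E : Type*} [AddCommMonoid E] [TopologicalSpace E]
    {P : α → Prop} [DecidablePred P] (hP : {x | P x}.Finite) (f : α → E) :
    ∑' x, (if P x then f x else 0) = ∑ x ∈ hP.toFinset, f x := by
  rw [tsum_eq_sum (s := hP.toFinset) fun x hx => if_neg (by simpa using hx)]
  exact Finset.sum_congr rfl fun x hx => if_pos (by simpa using hx)

/-- **Spectral restriction theorem for the Heisenberg nilmanifold, in explicit
eigenfunction form**: any linear combination `f` of the `μ²`-eigenfunctions of the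
sub-Laplacian satisfies `‖f‖_{L⁴([0,1]³)} ≤ C_ε μ^{1/2+ε} ‖f‖_{L²}`. -/
theorem heisenberg_spectral_restriction (ε : ℝ) (hε : 0 < ε) :
    ∃ C > (0 : ℝ), ∀ (μ : ℝ), 0 < μ → ∀ (cf : ℤ × ℤ → ℂ) (γ : ℤ → ℤ → ℕ → ℂ),
      (∫ a in Set.Icc (0:ℝ) 1, ∫ b in Set.Icc (0:ℝ) 1, ∫ c in Set.Icc (0:ℝ) 1,
          ‖(∑' ω : ℤ × ℤ,
                if 4 * π ^ 2 * ((ω.1 : ℝ) ^ 2 + (ω.2 : ℝ) ^ 2) = μ ^ 2 then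
                  cf ω * Complex.exp (2 * (π : ℂ) * Complex.I *
                    ((ω.1 : ℂ) * (a : ℂ) + (ω.2 : ℂ) * (b : ℂ)))
                else 0) +
              ∑' p : ℤ × ℕ,
                if p.1 ≠ 0 ∧ 2 * π * |(p.1 : ℝ)| * (2 * (p.2 : ℝ) + 1) = μ ^ 2 then
                  ∑' q : ZMod p.1.natAbs, γ p.1 (q.val : ℤ) p.2 * hBWZ p.1 (q.val : ℤ) p.2 (a, b, c)
                else 0‖ ^ 4) ^ ((1 : ℝ) / 4)
        ≤ C * μ ^ ((1 : ℝ) / 2 + ε) *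
            ((∑' ω : ℤ × ℤ,
                if 4 * π ^ 2 * ((ω.1 : ℝ) ^ 2 + (ω.2 : ℝ) ^ 2) = μ ^ 2 then ‖cf ω‖ ^ 2 else 0) +
              ∑' p : ℤ × ℕ,
                if p.1 ≠ 0 ∧ 2 * π * |(p.1 : ℝ)| * (2 * (p.2 : ℝ) + 1) = μ ^ 2 then
                  ∑' q : ZMod p.1.natAbs, ‖γ p.1 (q.val : ℤ) p.2‖ ^ 2
                else 0) ^ ((1 : ℝ) / 2) := by
  set D : ℝ := 8 * (36 + 608 * (1 + 1 / (2 * ε))) with hD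
  have hD0 : 0 < D := by positivity
  refine ⟨D ^ ((1 : ℝ) / 4), by positivity, fun μ hμ cf γ => ?_⟩
  simp only [tsum_ite_eq_sum_toFinset (finite_torus_spectrum hμ),
    tsum_ite_eq_sum_toFinset (finite_central_spectrum μ)]
  set s := (finite_torus_spectrum hμ).toFinset
  set t := (finite_central_spectrum μ).toFinset
  have hs : ∀ ω ∈ s, 4 * π ^ 2 * ((ω.1 : ℝ) ^ 2 + (ω.2 : ℝ) ^ 2) = μ ^ 2 := fun ω hω =>
    (finite_torus_spectrum hμ).mem_toFinset.1 hω
  have ht : ∀ p ∈ t, p.1 ≠ 0 ∧ 2 * π * |(p.1 : ℝ)| * (2 * (p.2 : ℝ) + 1) = μ ^ 2 := fun p hp =>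
    (finite_central_spectrum μ).mem_toFinset.1 hp
  set X : ℝ := ∑ ω ∈ s, ‖cf ω‖ ^ 2
  set Y : ℝ := ∑ p ∈ t, ∑' q : ZMod p.1.natAbs, ‖γ p.1 (q.val : ℤ) p.2‖ ^ 2
  have hX : 0 ≤ X := Finset.sum_nonneg fun _ _ => sq_nonneg _
  have hY : 0 ≤ Y := Finset.sum_nonneg fun _ _ => tsum_nonneg fun _ => sq_nonneg _
  have htorus : ∀ a b : ℝ, ‖∑ ω ∈ s, cf ω * Complex.exp (2 * (π : ℂ) * Complex.I *
      ((ω.1 : ℂ) * (a : ℂ) + (ω.2 : ℂ) * (b : ℂ)))‖ ^ 4 ≤ 36 * μ ^ (2 + 4 * ε) * X ^ 2 := by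
    intro a b
    refine (norm_torus_sum_pow_four_le s cf _ fun ω => ?_).trans ?_
    · rw [← norm_charE (ω.1 * a + ω.2 * b), charE]
      congr 2
      push_cast
      ring
    · have h : (s.card : ℝ) ^ 2 ≤ (6 * μ ^ (1 + 2 * ε)) ^ 2 := by
        gcongr
        exact card_torus_spectrum_le hε hμ hs
      have h2 : (6 * μ ^ (1 + 2 * ε)) ^ 2 = 36 * μ ^ (2 + 4 * ε) := by
        rw [mul_pow, ← Real.rpow_mul_natCast hμ.le]
        norm_num
        ring_nf
      rw [h2] at h
      gcongr
  have hcentral := lintegral_enorm_central_pow_four_le hε hμ ht γ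
  set T : ℝ → ℝ → ℂ := fun a b => ∑ ω ∈ s, cf ω * Complex.exp (2 * (π : ℂ) * Complex.I *
      ((ω.1 : ℂ) * (a : ℂ) + (ω.2 : ℂ) * (b : ℂ)))
  set H : ℝ → ℝ → ℝ → ℂ := fun a b c => ∑ p ∈ t, ∑' q : ZMod p.1.natAbs,
    γ p.1 (q.val : ℤ) p.2 * hBWZ p.1 (q.val : ℤ) p.2 (a, b, c)
  change (∫ a in Set.Icc (0:ℝ) 1, ∫ b in Set.Icc (0:ℝ) 1, ∫ c in Set.Icc (0:ℝ) 1,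
    ‖T a b + H a b c‖ ^ 4) ^ ((1 : ℝ) / 4) ≤ _
  have hpt : ∀ a b c : ℝ, ENNReal.ofReal (‖T a b + H a b c‖ ^ 4) ≤
      ENNReal.ofReal (8 * (36 * μ ^ (2 + 4 * ε) * X ^ 2)) + 8 * ‖H a b c‖ₑ ^ 4 := by
    intro a b c
    have h1 : ‖T a b + H a b c‖ ^ 4 ≤ 8 * (36 * μ ^ (2 + 4 * ε) * X ^ 2) + 8 * ‖H a b c‖ ^ 4 := by
      have h2 : (‖T a b‖ + ‖H a b c‖) ^ 4 ≤ 2 ^ (4 - 1) * (‖T a b‖ ^ 4 + ‖H a b c‖ ^ 4) :=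
        add_pow_le (norm_nonneg _) (norm_nonneg _) 4
      have h3 : ‖T a b + H a b c‖ ^ 4 ≤ (‖T a b‖ + ‖H a b c‖) ^ 4 := by
        gcongr
        exact norm_add_le _ _
      have h4 : ‖T a b‖ ^ 4 ≤ _ := htorus a b
      norm_num at h2
      linarith
    refine (ENNReal.ofReal_le_ofReal h1).trans (le_of_eq ?_)
    rw [ENNReal.ofReal_add (by positivity) (by positivity),
      ENNReal.ofReal_mul (q := ‖H a b c‖ ^ 4) (by norm_num), ENNReal.ofReal_pow (norm_nonneg _),
      ofReal_norm, ENNReal.ofReal_ofNat]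
  have hint : ∫ a in Set.Icc (0:ℝ) 1, ∫ b in Set.Icc (0:ℝ) 1, ∫ c in Set.Icc (0:ℝ) 1,
      ‖T a b + H a b c‖ ^ 4 ≤ D * μ ^ (2 + 4 * ε) * (X + Y) ^ 2 := by
    have h8 : (8 : ENNReal) ≠ ⊤ := ENNReal.ofNat_ne_top
    have hle : ∫ a in Set.Icc (0:ℝ) 1, ∫ b in Set.Icc (0:ℝ) 1, ∫ c in Set.Icc (0:ℝ) 1,
        ‖T a b + H a b c‖ ^ 4 ≤ 8 * (36 * μ ^ (2 + 4 * ε) * X ^ 2) +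
          8 * (608 * (1 + 1 / (2 * ε)) * μ ^ (2 + 4 * ε) * Y ^ 2) := by
      refine (ENNReal.ofReal_le_ofReal_iff (by positivity)).1 ?_
      refine (ofReal_integral_cube_le (fun a b c => by positivity) _).trans ?_
      refine (lintegral_mono fun a => lintegral_mono fun b => lintegral_mono fun c =>
        hpt a b c).trans ?_
      simp only [lintegral_unit_const_add_mul h8]
      rw [ENNReal.ofReal_add (by positivity) (by positivity),
        ENNReal.ofReal_mul (p := 8) (q := 608 * _ * _ * _) (by norm_num), ENNReal.ofReal_ofNat]
      gcongr
    refine hle.trans ?_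
    have hX2 : X ^ 2 ≤ (X + Y) ^ 2 := by gcongr; linarith
    have hY2 : Y ^ 2 ≤ (X + Y) ^ 2 := by gcongr; linarith
    calc _ ≤ 8 * (36 * μ ^ (2 + 4 * ε) * (X + Y) ^ 2) +
          8 * (608 * (1 + 1 / (2 * ε)) * μ ^ (2 + 4 * ε) * (X + Y) ^ 2) := by gcongr
      _ = _ := by rw [hD]; ring
  refine (Real.rpow_le_rpow ?_ hint (by norm_num)).trans (le_of_eq ?_)
  · exact integral_nonneg fun a => integral_nonneg fun b => integral_nonneg fun c => by positivity
  rw [Real.mul_rpow (by positivity) (by positivity), Real.mul_rpow hD0.le (by positivity),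
    ← Real.rpow_mul hμ.le, ← Real.rpow_natCast, ← Real.rpow_mul (by positivity)]
  congr 2
  · congr 1
    ring
  · norm_num
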